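/- arXiv:1505.07790 — 4 statements merged into one kernel-verified Lean document; each statement's English description precedes it below -/
import Mathlib

section
/- Let N > 0 be a natural number, K ≥ 0, and φ : ℝⁿ → ℝ a smooth function such that Hess φ(x)(ξ,ξ) + (1/N)⟨∇φ(x), ξ⟩² ≤ K|ξ|² for all x, ξ ∈ ℝⁿ (the Euclidean condition Ric_{∇φ}^N ≥ -K). Let b : ℝⁿ × [0,∞) → ℝ be a strictly negative function differentiable in the space variable with sup |∇√(−b)| < ∞, and let u be a smooth positive solution of ∂ₜu = Δu + ⟨∇φ, ∇u⟩ + b·u with 0 < u ≤ 1 on ℝⁿ × [0,∞). Then for every x ∈ ℝⁿ and t > 0: |∇u(x,t)|/u(x,t) ≤ (t^{-1/2} + √(2K) + (sup |∇√(−b)|)^{1/2})·(1 − log u(x,t)). -/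
open scoped RealInnerProductSpace ContDiff

/-- The Euclidean Laplacian of `f : ℝⁿ → ℝ` at `x`, i.e. the sum of its second partial
derivatives (the trace of its Hessian). -/
noncomputable def lap {n : ℕ} (f : EuclideanSpace ℝ (Fin n) → ℝ)
    (x : EuclideanSpace ℝ (Fin n)) : ℝ :=
  ∑ i : Fin n, fderiv ℝ (fun y => fderiv ℝ f y (EuclideanSpace.single i 1)) x
    (EuclideanSpace.single i 1)

open Filter Topology

section DirDeriv

variable {X : Type*} [NormedAddCommGroup X] [NormedSpace ℝ X]

/-- The derivative of `F` in the constant direction `v`, as a function. -/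
noncomputable def dirDeriv (v : X) (F : X → ℝ) (p : X) : ℝ := fderiv ℝ F p v

theorem ContDiffAt.dirDeriv {F : X → ℝ} {p : X} (hF : ContDiffAt ℝ ∞ F p) (v : X) :
    ContDiffAt ℝ ∞ (dirDeriv v F) p :=
  (hF.fderiv_right (m := ∞) (by simp)).clm_apply contDiffAt_const

theorem dirDeriv_comm {F : X → ℝ} {p : X} (hF : ContDiffAt ℝ ∞ F p) (v w : X) :
    dirDeriv v (dirDeriv w F) p = dirDeriv w (dirDeriv v F) p := by
  have hd : DifferentiableAt ℝ (fderiv ℝ F) p :=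
    (hF.fderiv_right (m := ∞) (by simp)).differentiableAt (by simp)
  have key : ∀ a b : X, dirDeriv a (dirDeriv b F) p = fderiv ℝ (fderiv ℝ F) p a b := by
    intro a b
    have h := hd.hasFDerivAt.clm_apply (hasFDerivAt_const b p)
    change fderiv ℝ (fun y => fderiv ℝ F y b) p a = _
    rw [h.fderiv]
    simp
  rw [key, key]
  exact (hF.isSymmSndFDerivAt (by simpa using ENat.LEInfty.out)).eq v w

theorem hasDerivAt_line {F : X → ℝ} {p v : X} {s : ℝ}
    (hF : DifferentiableAt ℝ F (p + s • v)) :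
    HasDerivAt (fun r : ℝ => F (p + r • v)) (dirDeriv v F (p + s • v)) s := by
  have h : HasDerivAt (fun r : ℝ => p + r • v) v s := by
    simpa using ((hasDerivAt_id s).smul_const v).const_add p
  exact hF.hasFDerivAt.comp_hasDerivAt s h

theorem hasDerivAt_line_zero {F : X → ℝ} {p : X} (v : X) (hF : DifferentiableAt ℝ F p) :
    HasDerivAt (fun r : ℝ => F (p + r • v)) (dirDeriv v F p) 0 := by
  have h := hasDerivAt_line (F := F) (p := p) (v := v) (s := 0) (by simpa using hF)
  simpa using h

theorem eventually_line {P : X → Prop} {p : X} (v : X) (h : ∀ᶠ y in 𝓝 p, P y) :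
    ∀ᶠ s : ℝ in 𝓝 0, P (p + s • v) := by
  have hc : Tendsto (fun s : ℝ => p + s • v) (𝓝 0) (𝓝 p) := by
    have : Continuous (fun s : ℝ => p + s • v) := by fun_prop
    simpa using this.tendsto 0
  exact hc.eventually h

theorem dirDeriv_comm₂ {F : X → ℝ} {p : X} (hF : ∀ᶠ y in 𝓝 p, ContDiffAt ℝ ∞ F y) (v w : X) :
    dirDeriv v (dirDeriv w (dirDeriv w F)) p = dirDeriv w (dirDeriv w (dirDeriv v F)) p := by
  rw [dirDeriv_comm (hF.self_of_nhds.dirDeriv w)]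
  have h : dirDeriv v (dirDeriv w F) =ᶠ[𝓝 p] dirDeriv w (dirDeriv v F) := by
    filter_upwards [hF] with y hy using dirDeriv_comm hy v w
  unfold dirDeriv at h ⊢
  rw [h.fderiv_eq]

end DirDeriv

/-- First and second order necessary conditions at a local maximum. -/
theorem IsLocalMax.second_deriv_nonpos {f f' : ℝ → ℝ} {f'' a : ℝ} (hmax : IsLocalMax f a)
    (hf : ∀ᶠ s in 𝓝 a, HasDerivAt f (f' s) s) (hf' : HasDerivAt f' f'' a) :
    f' a = 0 ∧ f'' ≤ 0 := by
  have h0 : f' a = 0 := hmax.hasDerivAt_eq_zero hf.self_of_nhds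
  refine ⟨h0, ?_⟩
  have hd : deriv f =ᶠ[𝓝 a] f' := by
    filter_upwards [hf] with s hs using hs.deriv
  have hdd : deriv (deriv f) a = f'' := by rw [hd.deriv_eq, hf'.deriv]
  by_contra! hpos
  have hmin : IsLocalMin f a :=
    isLocalMin_of_deriv_deriv_pos (by rw [hdd]; exact hpos) (by rw [hd.self_of_nhds, h0])
      hf.self_of_nhds.continuousAt
  have hconst : f =ᶠ[𝓝 a] fun _ => f a := by
    filter_upwards [hmax, hmin] with s h1 h2 using le_antisymm h1 h2
  have : deriv (deriv f) a = 0 := by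
    rw [hconst.deriv.deriv_eq]
    simp
  linarith

/-- Necessary conditions at a local maximum of the product of a quadratic polynomial and `q`. -/
theorem IsLocalMax.quadratic_mul {a₀ a₁ a₂ q'' : ℝ} {q q' : ℝ → ℝ}
    (hmax : IsLocalMax (fun s => (a₀ + a₁ * s + a₂ * s ^ 2) * q s) 0)
    (hq : ∀ᶠ s in 𝓝 0, HasDerivAt q (q' s) s) (hq' : HasDerivAt q' q'' 0) :
    a₁ * q 0 + a₀ * q' 0 = 0 ∧ 2 * a₂ * q 0 + 2 * a₁ * q' 0 + a₀ * q'' ≤ 0 := by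
  have hp : ∀ s : ℝ, HasDerivAt (fun s => a₀ + a₁ * s + a₂ * s ^ 2) (a₁ + 2 * a₂ * s) s := by
    intro s
    have h1 := ((hasDerivAt_id s).const_mul a₁).const_add a₀
    have h2 := ((hasDerivAt_id s).pow 2).const_mul a₂
    refine (h1.add h2).congr_deriv ?_
    simp
    ring
  have hp' : HasDerivAt (fun s => a₁ + 2 * a₂ * s) (2 * a₂) 0 := by
    simpa using ((hasDerivAt_id (0 : ℝ)).const_mul (2 * a₂)).const_add a₁
  have hf : ∀ᶠ s in 𝓝 0, HasDerivAt (fun s => (a₀ + a₁ * s + a₂ * s ^ 2) * q s)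
      ((a₁ + 2 * a₂ * s) * q s + (a₀ + a₁ * s + a₂ * s ^ 2) * q' s) s := by
    filter_upwards [hq] with s hs using (hp s).mul hs
  have hf' := (hp'.mul hq.self_of_nhds).add ((hp 0).mul hq')
  obtain ⟨h1, h2⟩ := hmax.second_deriv_nonpos hf hf'
  constructor
  · linarith
  · linarith

theorem HasDerivAt.nonneg_of_le_left {f : ℝ → ℝ} {f' a b : ℝ} (hab : a < b)
    (hf : HasDerivAt f f' b) (hle : ∀ s ∈ Set.Icc a b, f s ≤ f b) : 0 ≤ f' := by
  have hmax : IsLocalMaxOn f (Set.Icc a b) b := by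
    filter_upwards [self_mem_nhdsWithin] with s hs using hle s hs
  have h := hmax.hasFDerivWithinAt_nonpos (y := a - b) hf.hasFDerivAt.hasFDerivWithinAt
    (sub_mem_posTangentConeAt_of_segment_subset (by rw [segment_symm, segment_eq_Icc hab.le]))
  simp at h
  nlinarith

section Euclidean

variable {n : ℕ}

local notation "E" => EuclideanSpace ℝ (Fin n)

theorem euclidean_sum_single (ξ : E) :
    ξ = ∑ i, ξ i • EuclideanSpace.single i (1 : ℝ) := by
  ext j
  simp [Finset.sum_apply, Pi.single_apply]

theorem dirDeriv_eq_sum (f : E → ℝ) (v x : E) :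
    dirDeriv v f x = ∑ i, v i * dirDeriv (EuclideanSpace.single i 1) f x := by
  unfold dirDeriv
  conv_lhs => rw [euclidean_sum_single v]
  simp [map_sum]

theorem inner_gradient_eq_fderiv {f : E → ℝ} {x : E} (ξ : E) :
    ⟪gradient f x, ξ⟫ = fderiv ℝ f x ξ := by
  rw [← toDual_gradient, InnerProductSpace.toDual_apply_apply]

theorem gradient_apply {f : E → ℝ} {x : E} (i : Fin n) :
    gradient f x i = fderiv ℝ f x (EuclideanSpace.single i 1) := by
  rw [← inner_gradient_eq_fderiv, EuclideanSpace.inner_single_right]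
  simp

/-- The radial derivative of `φ` is bounded above, by comparison in the Riccati inequality
`p' + p² / N ≤ K` along rays. -/
theorem exists_radial_fderiv_le (N : ℕ) (hN : 0 < N)
    (φ : E → ℝ) (hφ : ContDiff ℝ ∞ φ) (K : ℝ)
    (hRic : ∀ x ξ : E,
      fderiv ℝ (fun y => fderiv ℝ φ y ξ) x ξ + (1 / (N : ℝ)) * ⟪gradient φ x, ξ⟫ ^ 2
        ≤ K * ‖ξ‖ ^ 2) :
    ∃ C : ℝ, 0 ≤ C ∧ ∀ x : E, fderiv ℝ φ x x ≤ C * ‖x‖ := by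
  have hN' : (0 : ℝ) < N := by exact_mod_cast hN
  set C : ℝ := ‖fderiv ℝ φ 0‖ + Real.sqrt (N * K) + 1 with hC
  have hCpos : 0 < C := by positivity
  refine ⟨C, hCpos.le, fun x => ?_⟩
  rcases eq_or_ne x 0 with rfl | hx
  · simp
  have hxn : 0 < ‖x‖ := norm_pos_iff.mpr hx
  set θ : E := ‖x‖⁻¹ • x with hθ
  have hθn : ‖θ‖ = 1 := by
    rw [hθ, norm_smul, norm_inv, norm_norm, inv_mul_cancel₀ hxn.ne']
  have hxθ : x = 0 + ‖x‖ • θ := by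
    rw [hθ, smul_smul, mul_inv_cancel₀ hxn.ne', one_smul, zero_add]
  have hder : ∀ s : ℝ, HasDerivAt (fun r : ℝ => dirDeriv θ φ (0 + r • θ))
      (dirDeriv θ (dirDeriv θ φ) (0 + s • θ)) s := fun s =>
    hasDerivAt_line ((hφ.contDiffAt.dirDeriv θ).differentiableAt (by simp))
  have hcmp := image_le_of_deriv_right_lt_deriv_boundary (a := 0) (b := ‖x‖)
    (f := fun r : ℝ => dirDeriv θ φ (0 + r • θ)) (B := fun _ => C) (B' := fun _ => 0)
    (fun s _ => (hder s).continuousAt.continuousWithinAt)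
    (fun s _ => (hder s).hasDerivWithinAt)
    (by
      have h := (fderiv ℝ φ 0).le_opNorm θ
      rw [hθn, mul_one] at h
      have h2 := le_of_abs_le h
      have h3 : 0 ≤ Real.sqrt (N * K) := Real.sqrt_nonneg _
      simp only [zero_smul, add_zero, dirDeriv]
      linarith)
    (fun s => hasDerivAt_const s C)
    (by
      intro s _ hs
      have h := hRic (0 + s • θ) θ
      rw [inner_gradient_eq_fderiv, hθn] at h
      change dirDeriv θ (dirDeriv θ φ) (0 + s • θ)
        + 1 / (N : ℝ) * (dirDeriv θ φ (0 + s • θ)) ^ 2 ≤ _ at h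
      rw [hs] at h
      have hlt : N * K < C ^ 2 := by
        have h1 : 0 ≤ ‖fderiv ℝ φ 0‖ := norm_nonneg _
        have h2 : Real.sqrt (N * K) < C := by linarith
        exact (Real.sqrt_lt' hCpos).mp h2
      have : K < 1 / (N : ℝ) * C ^ 2 := by
        rw [one_div, inv_mul_eq_div, lt_div_iff₀ hN']
        linarith
      linarith)
  have h := hcmp (Set.right_mem_Icc.mpr hxn.le)
  rw [← hxθ] at h
  calc fderiv ℝ φ x x = fderiv ℝ φ x (‖x‖ • θ) := by rw [← zero_add (‖x‖ • θ), ← hxθ]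
    _ = ‖x‖ * dirDeriv θ φ x := by rw [map_smul, smul_eq_mul, dirDeriv]
    _ ≤ C * ‖x‖ := by nlinarith

/-- The `i`-th spatial coordinate direction in space-time. -/
noncomputable def coordDir (i : Fin n) : E × ℝ := (EuclideanSpace.single i 1, 0)

theorem dirDeriv_space (F : E × ℝ → ℝ) (ξ : E) (p : E × ℝ) :
    dirDeriv (ξ, 0) F p = ∑ i, ξ i * dirDeriv (coordDir i) F p := by
  have h : ((ξ, 0) : E × ℝ) = ∑ i, ξ i • coordDir i := by
    refine Prod.ext ?_ ?_
    · simpa [coordDir, Prod.fst_sum] using euclidean_sum_single ξ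
    · simp [coordDir, Prod.snd_sum]
  rw [h]
  simp [dirDeriv, map_sum]

theorem fderiv_slice {F : E × ℝ → ℝ} {x : E} {t : ℝ} (hF : DifferentiableAt ℝ F (x, t)) (ξ : E) :
    fderiv ℝ (fun y => F (y, t)) x ξ = dirDeriv (ξ, 0) F (x, t) := by
  have h : HasFDerivAt (fun y : E => (y, t)) (ContinuousLinearMap.inl ℝ E ℝ) x :=
    hasFDerivAt_prodMk_left x t
  have h2 := hF.hasFDerivAt.comp x h
  change fderiv ℝ (F ∘ fun y : E => (y, t)) x ξ = _
  rw [h2.fderiv]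
  simp [dirDeriv]

theorem hasDerivAt_time {F : E × ℝ → ℝ} {x : E} {t : ℝ} (hF : DifferentiableAt ℝ F (x, t)) :
    HasDerivAt (fun s => F (x, s)) (dirDeriv (0, 1) F (x, t)) t := by
  have h : HasDerivAt (fun s : ℝ => (x, s)) ((0 : E), (1 : ℝ)) t :=
    (hasDerivAt_const t x).prodMk (hasDerivAt_id t)
  exact hF.hasFDerivAt.comp_hasDerivAt t h

theorem prod_line (x ξ : E) (t s : ℝ) :
    ((x, t) : E × ℝ) + s • ((ξ, 0) : E × ℝ) = (x + s • ξ, t) := by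
  simp

/-- Differentiating the equation satisfied by `G` in a fixed spatial direction. -/
theorem linearized_equation {G : E × ℝ → ℝ} {φ : E → ℝ} (hφ : ContDiff ℝ ∞ φ) {c : E → ℝ}
    {x : E} {t : ℝ} (hG : ∀ᶠ p in 𝓝 (x, t), ContDiffAt ℝ ∞ G p) (hc : DifferentiableAt ℝ c x)
    (heq : ∀ y : E, dirDeriv (0, 1) G (y, t) =
      ∑ i, dirDeriv (coordDir i) (dirDeriv (coordDir i) G) (y, t)
      + ∑ i, dirDeriv (EuclideanSpace.single i 1) φ y * dirDeriv (coordDir i) G (y, t)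
      + (1 - Real.exp (G (y, t))) * ∑ i, (dirDeriv (coordDir i) G (y, t)) ^ 2
      + c y ^ 2 * Real.exp (-G (y, t)))
    (ξ : E) :
    dirDeriv (0, 1) (dirDeriv (ξ, 0) G) (x, t) =
      ∑ i, dirDeriv (coordDir i) (dirDeriv (coordDir i) (dirDeriv (ξ, 0) G)) (x, t)
      + ∑ i, (dirDeriv ξ (dirDeriv (EuclideanSpace.single i 1) φ) x
            * dirDeriv (coordDir i) G (x, t)
          + dirDeriv (EuclideanSpace.single i 1) φ x
            * dirDeriv (coordDir i) (dirDeriv (ξ, 0) G) (x, t))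
      + (-(Real.exp (G (x, t)) * dirDeriv (ξ, 0) G (x, t))
            * ∑ i, (dirDeriv (coordDir i) G (x, t)) ^ 2
          + (1 - Real.exp (G (x, t))) * ∑ i, 2 * dirDeriv (coordDir i) G (x, t)
              * dirDeriv (coordDir i) (dirDeriv (ξ, 0) G) (x, t))
      + (2 * c x * dirDeriv ξ c x * Real.exp (-G (x, t))
          + c x ^ 2 * (Real.exp (-G (x, t)) * -dirDeriv (ξ, 0) G (x, t))) := by
  have hG0 := hG.self_of_nhds
  have line : ∀ {F : E × ℝ → ℝ}, ContDiffAt ℝ ∞ F (x, t) →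
      HasDerivAt (fun s : ℝ => F (x + s • ξ, t)) (dirDeriv (ξ, 0) F (x, t)) 0 := by
    intro F hF
    have h := hasDerivAt_line_zero (ξ, 0) (hF.differentiableAt (by simp))
    simpa only [prod_line] using h
  have d1 := HasDerivAt.fun_sum (u := Finset.univ) fun i (_ : i ∈ Finset.univ) =>
    line ((hG0.dirDeriv (coordDir i)).dirDeriv (coordDir i))
  have d2 := HasDerivAt.fun_sum (u := Finset.univ) fun i (_ : i ∈ Finset.univ) =>
    (hasDerivAt_line_zero ξ ((hφ.contDiffAt.dirDeriv
      (EuclideanSpace.single i (1 : ℝ))).differentiableAt (x := x) (by simp))).mul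
      (line (hG0.dirDeriv (coordDir i)))
  have d3 := HasDerivAt.fun_sum (u := Finset.univ) fun i (_ : i ∈ Finset.univ) =>
    (line (hG0.dirDeriv (coordDir i))).pow 2
  have d4 := ((line hG0).exp.const_sub 1).mul d3
  have d5 := ((hasDerivAt_line_zero ξ hc).pow 2).mul (line hG0).neg.exp
  have hR := ((d1.add d2).add d4).add d5
  have hL := line (hG0.dirDeriv (0, 1))
  have huniq := hL.unique (hR.congr_of_eventuallyEq (Eventually.of_forall fun s => by
    simpa using heq (x + s • ξ)))
  rw [← dirDeriv_comm hG0, huniq]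
  simp only [zero_smul, add_zero, Pi.pow_apply, dirDeriv_comm₂ hG, dirDeriv_comm hG0 (ξ, 0)]
  simp

theorem norm_sq_add_smul_single (x : E) (i : Fin n) (s : ℝ) :
    ‖x + s • EuclideanSpace.single i (1 : ℝ)‖ ^ 2 = ‖x‖ ^ 2 + 2 * x i * s + s ^ 2 := by
  rw [norm_add_sq_real, norm_smul, inner_smul_right, EuclideanSpace.inner_single_right]
  simp
  ring

/-- The algebra combining the bounds on each term of the linearized equation at a maximum. -/
theorem cutoff_inequality_of_bounds {t K C B ρ q σ z L m qt S₁ S₂ S₃ S₄ β : ℝ}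
    (ht : 0 < t) (hK : 0 ≤ K) (hC : 0 ≤ C) (hρ : 0 < ρ) (hq : 0 < q)
    (hσ0 : 0 < σ) (hσ1 : σ ≤ 1) (hL1 : 1 ≤ L) (hz : z = σ * q)
    (htime : 0 ≤ q ^ 2 + 2 * t * q * qt)
    (hlin : qt = S₁ + (S₃ + S₂) + (-(L * q) * q ^ 2 + (1 - L) * S₄) + β)
    (b1 : σ ^ 2 * S₁ ≤ m * ρ ^ 2 * q) (b2 : σ * S₂ ≤ 2 * ρ * C * q) (b3 : S₃ ≤ K * q)
    (b4 : -(4 * ρ * q ^ 2) ≤ σ * S₄) (b5 : q * β ≤ B ^ 2) :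
    L * z ^ 4 ≤ 4 * (L - 1) * ρ * z ^ 3
      + z ^ 2 * (1 / (2 * t) + K + (m * ρ ^ 2 + 2 * ρ * C)) + B ^ 2 := by
  have t1 : σ ^ 4 * q * S₁ ≤ z ^ 2 * (m * ρ ^ 2) := by
    have := mul_le_mul_of_nonneg_left b1 (by positivity : 0 ≤ σ ^ 2 * q)
    rw [hz]; linarith
  have hσ2 : σ ^ 2 ≤ 1 := pow_le_one₀ hσ0.le hσ1
  have hσ4 : σ ^ 4 ≤ 1 := pow_le_one₀ hσ0.le hσ1
  have t2 : σ ^ 4 * q * S₂ ≤ z ^ 2 * (2 * ρ * C) := by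
    have h1 := mul_le_mul_of_nonneg_left b2 (by positivity : 0 ≤ σ ^ 3 * q)
    have h2 : z ^ 2 * (2 * ρ * C) * σ ≤ z ^ 2 * (2 * ρ * C) :=
      mul_le_of_le_one_right (by positivity) hσ1
    rw [hz] at h2 ⊢; linarith
  have t3 : σ ^ 4 * q * S₃ ≤ z ^ 2 * K := by
    have h1 := mul_le_mul_of_nonneg_left b3 (by positivity : 0 ≤ σ ^ 4 * q)
    have h2 : z ^ 2 * K * σ ^ 2 ≤ z ^ 2 * K :=
      mul_le_of_le_one_right (by positivity) hσ2
    rw [hz] at h2 ⊢; linarith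
  have t4 : σ ^ 4 * q * ((1 - L) * S₄) ≤ 4 * (L - 1) * ρ * z ^ 3 := by
    have h1 := mul_le_mul_of_nonneg_left b4
      (mul_nonneg (sub_nonneg.mpr hL1) (by positivity : 0 ≤ σ ^ 3 * q))
    rw [hz]; linarith
  have t5 : σ ^ 4 * q * β ≤ B ^ 2 := by
    have h1 := mul_le_mul_of_nonneg_left b5 (by positivity : 0 ≤ σ ^ 4)
    have h2 : σ ^ 4 * B ^ 2 ≤ B ^ 2 := mul_le_of_le_one_left (sq_nonneg B) hσ4
    linarith
  have t6 : -(z ^ 2 * (1 / (2 * t))) ≤ σ ^ 4 * q * qt := by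
    have h1 : -(q ^ 2 * (1 / (2 * t))) ≤ q * qt := by
      have : q * qt = (q ^ 2 + 2 * t * q * qt) / (2 * t) - q ^ 2 * (1 / (2 * t)) := by
        field_simp; ring
      rw [this]
      have := div_nonneg htime (by positivity : 0 ≤ 2 * t)
      linarith
    have h2 := mul_le_mul_of_nonneg_left h1 (by positivity : 0 ≤ σ ^ 4)
    have h3 : z ^ 2 * (1 / (2 * t)) * σ ^ 2 ≤ z ^ 2 * (1 / (2 * t)) :=
      mul_le_of_le_one_right (by positivity) hσ2
    rw [hz] at h3 ⊢; linarith
  have hexp : σ ^ 4 * q * qt = σ ^ 4 * q * S₁ + (σ ^ 4 * q * S₃ + σ ^ 4 * q * S₂)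
      + (-(L * z ^ 4) + σ ^ 4 * q * ((1 - L) * S₄)) + σ ^ 4 * q * β := by
    rw [hlin, hz]; ring
  linarith

/-- The inequality satisfied at a maximum point of `t (1 - ρ² |x|²)² |∇G|²`. -/
theorem max_point_inequality {G : E × ℝ → ℝ} {φ : E → ℝ} (hφ : ContDiff ℝ ∞ φ) {c : E → ℝ}
    {K B C ρ : ℝ} (hK : 0 ≤ K) (hC : 0 ≤ C) (hρ : 0 < ρ)
    (hHess : ∀ x ξ : E, dirDeriv ξ (dirDeriv ξ φ) x ≤ K * ‖ξ‖ ^ 2)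
    (hdrift : ∀ x : E, fderiv ℝ φ x x ≤ C * ‖x‖)
    {x : E} {t : ℝ} (ht : 0 < t) (hx : ρ * ‖x‖ < 1)
    (hG : ∀ᶠ p in 𝓝 (x, t), ContDiffAt ℝ ∞ G p) (hGnn : 0 ≤ G (x, t))
    (hc : DifferentiableAt ℝ c x)
    (hcB : ∀ ξ : E, |dirDeriv ξ c x| ≤ B * ‖ξ‖)
    (heq : ∀ y : E, dirDeriv (0, 1) G (y, t) =
      ∑ i, dirDeriv (coordDir i) (dirDeriv (coordDir i) G) (y, t)
      + ∑ i, dirDeriv (EuclideanSpace.single i 1) φ y * dirDeriv (coordDir i) G (y, t)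
      + (1 - Real.exp (G (y, t))) * ∑ i, (dirDeriv (coordDir i) G (y, t)) ^ 2
      + c y ^ 2 * Real.exp (-G (y, t)))
    (hmax : ∀ (y : E) (s : ℝ), ρ * ‖y‖ ≤ 1 → 0 ≤ s → s ≤ t →
      s * (1 - ρ ^ 2 * ‖y‖ ^ 2) ^ 2 * ∑ i, (dirDeriv (coordDir i) G (y, s)) ^ 2
        ≤ t * (1 - ρ ^ 2 * ‖x‖ ^ 2) ^ 2 * ∑ i, (dirDeriv (coordDir i) G (x, t)) ^ 2)
    {q z : ℝ} (hq : 0 < q) (hqG : q ^ 2 = ∑ i, (dirDeriv (coordDir i) G (x, t)) ^ 2)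
    (hz : z = (1 - ρ ^ 2 * ‖x‖ ^ 2) * q) :
    0 < z ∧ Real.exp (G (x, t)) * z ^ 4 ≤ 4 * (Real.exp (G (x, t)) - 1) * ρ * z ^ 3
      + z ^ 2 * (1 / (2 * t) + K + ((2 * n + 8) * ρ ^ 2 + 2 * ρ * C)) + B ^ 2 := by
  have hG0 := hG.self_of_nhds
  set σ : ℝ := 1 - ρ ^ 2 * ‖x‖ ^ 2 with hσ
  have hρx : 0 ≤ ρ * ‖x‖ := by positivity
  have hσ0 : 0 < σ := by
    have : ρ ^ 2 * ‖x‖ ^ 2 = (ρ * ‖x‖) ^ 2 := by ring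
    rw [hσ, this]; nlinarith
  have hσ1 : σ ≤ 1 := by
    have : 0 ≤ ρ ^ 2 * ‖x‖ ^ 2 := by positivity
    linarith
  have hz0 : 0 < z := by rw [hz]; positivity
  refine ⟨hz0, ?_⟩
  set g : Fin n → ℝ := fun i => dirDeriv (coordDir i) G (x, t)
  have hgq : q ^ 2 = ∑ i, g i ^ 2 := hqG
  set ξ : E := WithLp.toLp 2 (fun i => g i / q)
  have hξi : ∀ i, ξ i = g i / q := fun i => rfl
  have hgi : ∀ i, g i = q * ξ i := fun i => by rw [hξi]; field_simp
  have hξsum : ∑ i, ξ i ^ 2 = 1 := by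
    simp only [hξi, div_pow]
    rw [← Finset.sum_div, ← hgq, div_self (by positivity)]
  have hξn : ‖ξ‖ ^ 2 = 1 := by
    rw [EuclideanSpace.norm_sq_eq]; simpa using hξsum
  have hξn1 : ‖ξ‖ = 1 := by
    have := norm_nonneg ξ
    nlinarith
  set Q : E × ℝ → ℝ := dirDeriv (ξ, 0) G with hQ
  have hQsm : ∀ᶠ p in 𝓝 (x, t), ContDiffAt ℝ ∞ Q p := by
    filter_upwards [hG] with p hp using hp.dirDeriv _
  have hQ0 := hQsm.self_of_nhds
  have hQq : Q (x, t) = q := by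
    rw [hQ, dirDeriv_space]
    change ∑ i, ξ i * g i = q
    have : ∀ i, ξ i * g i = q * ξ i ^ 2 := fun i => by rw [hgi]; ring
    simp only [this, ← Finset.mul_sum, hξsum, mul_one]
  have hQle : ∀ p, Q p ^ 2 ≤ ∑ i, (dirDeriv (coordDir i) G p) ^ 2 := by
    intro p
    rw [hQ, dirDeriv_space]
    refine (Finset.sum_mul_sq_le_sq_mul_sq _ _ _).trans ?_
    rw [hξsum, one_mul]
  -- Time derivative.
  have htime : 0 ≤ q ^ 2 + 2 * t * q * dirDeriv (0, 1) Q (x, t) := by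
    have hd := (hasDerivAt_id t).mul
      ((hasDerivAt_time (hQ0.differentiableAt (by simp))).pow 2)
    have h := hd.nonneg_of_le_left ht (by
      intro s hs
      have h1 := hmax x s hx.le hs.1 hs.2
      rw [← hqG] at h1
      simp only [Pi.mul_apply, id, Pi.pow_apply]
      rw [hQq]
      have h2 := mul_le_mul_of_nonneg_left (hQle (x, s))
        (mul_nonneg hs.1 (sq_nonneg σ))
      have h3 : σ ^ 2 * (s * Q (x, s) ^ 2) ≤ σ ^ 2 * (t * q ^ 2) := by linarith
      exact le_of_mul_le_mul_left h3 (by positivity))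
    simp only [Pi.pow_apply, id, hQq] at h
    norm_num at h
    linarith
  -- Spatial derivatives.
  have hspace : ∀ i, -(2 * ρ ^ 2 * x i) * q + σ * dirDeriv (coordDir i) Q (x, t) = 0 ∧
      2 * (-ρ ^ 2) * q + 2 * -(2 * ρ ^ 2 * x i) * dirDeriv (coordDir i) Q (x, t)
        + σ * dirDeriv (coordDir i) (dirDeriv (coordDir i) Q) (x, t) ≤ 0 := by
    intro i
    have hl : IsLocalMax (fun s : ℝ => (σ + -(2 * ρ ^ 2 * x i) * s + -ρ ^ 2 * s ^ 2)
        * Q ((x, t) + s • coordDir i)) 0 := by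
      have hev : ∀ᶠ y : E in 𝓝 x, ρ * ‖y‖ < 1 := by
        have hcont : Continuous fun y : E => ρ * ‖y‖ := by fun_prop
        exact hcont.continuousAt.eventually_lt continuousAt_const hx
      have hev' := eventually_line (EuclideanSpace.single i (1 : ℝ)) hev
      filter_upwards [hev'] with s hs
      rw [coordDir, prod_line, prod_line]
      have hσs : σ + -(2 * ρ ^ 2 * x i) * s + -ρ ^ 2 * s ^ 2
          = 1 - ρ ^ 2 * ‖x + s • EuclideanSpace.single i (1 : ℝ)‖ ^ 2 := by
        rw [norm_sq_add_smul_single, hσ]; ring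
      rw [hσs]
      simp only [zero_smul, mul_zero, add_zero, ne_eq, OfNat.ofNat_ne_zero, not_false_eq_true,
        zero_pow, hQq]
      set y := x + s • EuclideanSpace.single i (1 : ℝ)
      have h1 := hmax y t hs.le ht.le le_rfl
      rw [← hqG] at h1
      have h2 := mul_le_mul_of_nonneg_left (hQle (y, t))
        (mul_nonneg ht.le (sq_nonneg (1 - ρ ^ 2 * ‖y‖ ^ 2)))
      have h3 : t * ((1 - ρ ^ 2 * ‖y‖ ^ 2) * Q (y, t)) ^ 2 ≤ t * (σ * q) ^ 2 := by
        calc _ = t * (1 - ρ ^ 2 * ‖y‖ ^ 2) ^ 2 * Q (y, t) ^ 2 := by ring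
          _ ≤ t * σ ^ 2 * q ^ 2 := h2.trans h1
          _ = _ := by ring
      exact le_of_abs_le (abs_le_of_sq_le_sq (le_of_mul_le_mul_left h3 ht) (by positivity))
    have hq1 : ∀ᶠ s : ℝ in 𝓝 0, HasDerivAt (fun s : ℝ => Q ((x, t) + s • coordDir i))
        (dirDeriv (coordDir i) Q ((x, t) + s • coordDir i)) s := by
      filter_upwards [eventually_line (coordDir i) hQsm] with s hs
        using hasDerivAt_line (hs.differentiableAt (by simp))
    have h := hl.quadratic_mul hq1 (hasDerivAt_line_zero (coordDir i)
      ((hQ0.dirDeriv (coordDir i)).differentiableAt (by simp)))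
    simpa only [zero_smul, add_zero, hQq] using h
  have hgrad : ∀ i, σ * dirDeriv (coordDir i) Q (x, t) = 2 * ρ ^ 2 * q * x i := by
    intro i
    have := (hspace i).1
    linarith
  have hlin := linearized_equation hφ hG hc heq ξ
  rw [← hQ, Finset.sum_add_distrib, hQq, ← hqG] at hlin
  set L := Real.exp (G (x, t))
  have hL1 : 1 ≤ L := Real.one_le_exp hGnn
  set qt := dirDeriv (0, 1) Q (x, t)
  set S1 := ∑ i, dirDeriv (coordDir i) (dirDeriv (coordDir i) Q) (x, t) with hS1
  set S3 := ∑ i, dirDeriv ξ (dirDeriv (EuclideanSpace.single i 1) φ) x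
            * dirDeriv (coordDir i) G (x, t) with hS3
  set S2 := ∑ i, dirDeriv (EuclideanSpace.single i 1) φ x * dirDeriv (coordDir i) Q (x, t) with hS2
  set S4 := ∑ i, 2 * dirDeriv (coordDir i) G (x, t) * dirDeriv (coordDir i) Q (x, t) with hS4
  have b1 : σ ^ 2 * S1 ≤ (2 * n + 8) * ρ ^ 2 * q := by
    have hterm : ∀ i, σ ^ 2 * dirDeriv (coordDir i) (dirDeriv (coordDir i) Q) (x, t)
        ≤ 2 * ρ ^ 2 * q + 8 * ρ ^ 4 * q * x i ^ 2 := by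
      intro i
      have h1 := mul_le_mul_of_nonneg_left (hspace i).2 hσ0.le
      have h2 : 2 * ρ ^ 2 * q * σ ≤ 2 * ρ ^ 2 * q :=
        mul_le_of_le_one_right (by positivity) hσ1
      have h3 : 4 * ρ ^ 2 * x i * (σ * dirDeriv (coordDir i) Q (x, t))
          = 4 * ρ ^ 2 * x i * (2 * ρ ^ 2 * q * x i) := by rw [hgrad]
      linarith
    have hsum := Finset.sum_le_sum fun i (_ : i ∈ Finset.univ) => hterm i
    rw [← Finset.mul_sum, ← hS1, Finset.sum_add_distrib, Finset.sum_const, Finset.card_univ,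
      Fintype.card_fin, nsmul_eq_mul, ← Finset.mul_sum] at hsum
    have hxs : ∑ i, x i ^ 2 = ‖x‖ ^ 2 := by rw [EuclideanSpace.norm_sq_eq]; simp
    rw [hxs] at hsum
    have h4 : 8 * ρ ^ 4 * q * ‖x‖ ^ 2 ≤ 8 * ρ ^ 2 * q := by
      have : 8 * ρ ^ 4 * q * ‖x‖ ^ 2 = 8 * ρ ^ 2 * q * (1 - σ) := by rw [hσ]; ring
      rw [this]
      exact mul_le_of_le_one_right (by positivity) (by linarith)
    linarith
  have b2 : σ * S2 ≤ 2 * ρ * C * q := by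
    have h1 : σ * S2 = 2 * ρ ^ 2 * q * fderiv ℝ φ x x := by
      have h2 : fderiv ℝ φ x x = ∑ i, x i * dirDeriv (EuclideanSpace.single i 1) φ x :=
        dirDeriv_eq_sum φ x x
      rw [h2, hS2, Finset.mul_sum, Finset.mul_sum]
      refine Finset.sum_congr rfl fun i _ => ?_
      linear_combination dirDeriv (EuclideanSpace.single i 1) φ x * hgrad i
    rw [h1]
    have h3 := mul_le_mul_of_nonneg_left (hdrift x) (by positivity : 0 ≤ 2 * ρ ^ 2 * q)
    have h4 : 2 * ρ * C * q * (ρ * ‖x‖) ≤ 2 * ρ * C * q :=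
      mul_le_of_le_one_right (by positivity) hx.le
    linarith
  have b3 : S3 ≤ K * q := by
    have h1 : S3 = q * dirDeriv ξ (dirDeriv ξ φ) x := by
      have h2 : dirDeriv ξ φ = fun y => ∑ i, ξ i * dirDeriv (EuclideanSpace.single i 1) φ y :=
        funext (dirDeriv_eq_sum φ ξ)
      have h3 : HasFDerivAt (dirDeriv ξ φ)
          (∑ i, ξ i • fderiv ℝ (dirDeriv (EuclideanSpace.single i 1) φ) x) x := by
        rw [h2]
        exact HasFDerivAt.fun_sum fun i _ =>
          (((hφ.contDiffAt.dirDeriv _).differentiableAt (by simp)).hasFDerivAt.const_mul (ξ i))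
      have h4 : dirDeriv ξ (dirDeriv ξ φ) x
          = ∑ i, ξ i * dirDeriv ξ (dirDeriv (EuclideanSpace.single i 1) φ) x := by
        conv_lhs => unfold dirDeriv
        change fderiv ℝ (dirDeriv ξ φ) x ξ = _
        rw [h3.fderiv]
        simp [dirDeriv]
      rw [h4, hS3, Finset.mul_sum]
      refine Finset.sum_congr rfl fun i _ => ?_
      change _ * g i = _
      rw [hgi]; ring
    have h5 := hHess x ξ
    rw [hξn, mul_one] at h5
    rw [h1, mul_comm K]
    exact mul_le_mul_of_nonneg_left h5 hq.le
  have b4 : -(4 * ρ * q ^ 2) ≤ σ * S4 := by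
    have h1 : σ * S4 = 4 * ρ ^ 2 * q * ∑ i, g i * x i := by
      rw [hS4, Finset.mul_sum, Finset.mul_sum]
      refine Finset.sum_congr rfl fun i _ => ?_
      linear_combination 2 * g i * hgrad i
    have h2 : |∑ i, g i * x i| ≤ q * ‖x‖ := by
      refine abs_le_of_sq_le_sq ?_ (by positivity)
      refine (Finset.sum_mul_sq_le_sq_mul_sq _ _ _).trans ?_
      rw [mul_pow, hgq, EuclideanSpace.norm_sq_eq]
      simp
    have h3 := (abs_le.mp h2).1
    rw [h1]
    have h4 := mul_le_mul_of_nonneg_left h3 (by positivity : 0 ≤ 4 * ρ ^ 2 * q)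
    have h5 : 4 * ρ * q ^ 2 * (ρ * ‖x‖) ≤ 4 * ρ * q ^ 2 :=
      mul_le_of_le_one_right (by positivity) hx.le
    linarith
  set β := 2 * c x * dirDeriv ξ c x * Real.exp (-G (x, t))
          + c x ^ 2 * (Real.exp (-G (x, t)) * -q) with hβ
  have b5 : q * β ≤ B ^ 2 := by
    have h1 := hcB ξ
    rw [hξn1, mul_one] at h1
    have h2 : dirDeriv ξ c x ^ 2 ≤ B ^ 2 := sq_le_sq' (by linarith [(abs_le.mp h1).1])
      (le_of_abs_le h1)
    have h3 : Real.exp (-G (x, t)) ≤ 1 := Real.exp_le_one_iff.mpr (by linarith)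
    have h4 := Real.exp_pos (-G (x, t))
    have h5 : q * β = Real.exp (-G (x, t))
        * (dirDeriv ξ c x ^ 2 - (c x * q - dirDeriv ξ c x) ^ 2) := by rw [hβ]; ring
    rw [h5]
    have h6 : dirDeriv ξ c x ^ 2 - (c x * q - dirDeriv ξ c x) ^ 2 ≤ B ^ 2 := by
      linarith [sq_nonneg (c x * q - dirDeriv ξ c x)]
    calc _ ≤ Real.exp (-G (x, t)) * B ^ 2 := mul_le_mul_of_nonneg_left h6 h4.le
      _ ≤ B ^ 2 := mul_le_of_le_one_left (sq_nonneg B) h3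
  exact cutoff_inequality_of_bounds ht hK hC hρ hq hσ0 hσ1 hL1 hz htime hlin b1 b2 b3 b4 b5

/-- The gradient estimate for `G = log (1 - log u)`. -/
theorem sum_sq_dirDeriv_le {G : E × ℝ → ℝ} {φ : E → ℝ} (hφ : ContDiff ℝ ∞ φ) {c : E → ℝ → ℝ}
    {K B C : ℝ} (hK : 0 ≤ K) (hB : 0 ≤ B) (hC : 0 ≤ C)
    (hHess : ∀ x ξ : E, dirDeriv ξ (dirDeriv ξ φ) x ≤ K * ‖ξ‖ ^ 2)
    (hdrift : ∀ x : E, fderiv ℝ φ x x ≤ C * ‖x‖)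
    (hG : ∀ (x : E) (t : ℝ), 0 ≤ t → ∀ᶠ p in 𝓝 (x, t), ContDiffAt ℝ ∞ G p)
    (hGnn : ∀ (x : E) (t : ℝ), 0 ≤ t → 0 ≤ G (x, t))
    (hc : ∀ (x : E) (t : ℝ), 0 ≤ t → DifferentiableAt ℝ (fun y => c y t) x)
    (hcB : ∀ (x : E) (t : ℝ), 0 ≤ t → ∀ ξ : E, |dirDeriv ξ (fun y => c y t) x| ≤ B * ‖ξ‖)
    (heq : ∀ (y : E) (t : ℝ), 0 ≤ t → dirDeriv (0, 1) G (y, t) =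
      ∑ i, dirDeriv (coordDir i) (dirDeriv (coordDir i) G) (y, t)
      + ∑ i, dirDeriv (EuclideanSpace.single i 1) φ y * dirDeriv (coordDir i) G (y, t)
      + (1 - Real.exp (G (y, t))) * ∑ i, (dirDeriv (coordDir i) G (y, t)) ^ 2
      + c y t ^ 2 * Real.exp (-G (y, t)))
    (x : E) {t : ℝ} (ht : 0 < t) :
    ∑ i, (dirDeriv (coordDir i) G (x, t)) ^ 2 ≤ 1 / t + 2 * K + B := by
  by_contra! hlt
  set w : E × ℝ → ℝ := fun p => ∑ i, (dirDeriv (coordDir i) G p) ^ 2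
  change 1 / t + 2 * K + B < w (x, t) at hlt
  have hwt : 1 + (2 * K + B) * t < t * w (x, t) := by
    have := mul_lt_mul_of_pos_left hlt ht
    have h1 : t * (1 / t + 2 * K + B) = 1 + (2 * K + B) * t := by field_simp; ring
    linarith
  obtain ⟨ρ, hρx, hρw, hρt, hρδ, hρ⟩ : ∃ ρ : ℝ, ρ * ‖x‖ < 1 ∧
      1 + (2 * K + B) * t < t * (1 - ρ ^ 2 * ‖x‖ ^ 2) ^ 2 * w (x, t) ∧
      16 * ρ ^ 2 < 1 / t ∧ (2 * n + 8) * ρ ^ 2 + 2 * ρ * C < 1 / (2 * t) ∧ 0 < ρ := by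
    have e1 : ∀ᶠ ρ : ℝ in 𝓝 0, ρ * ‖x‖ < 1 :=
      ContinuousAt.eventually_lt (by fun_prop) continuousAt_const (by simp)
    have e2 : ∀ᶠ ρ : ℝ in 𝓝 0,
        1 + (2 * K + B) * t < t * (1 - ρ ^ 2 * ‖x‖ ^ 2) ^ 2 * w (x, t) :=
      ContinuousAt.eventually_lt continuousAt_const (by fun_prop) (by simpa using hwt)
    have e3 : ∀ᶠ ρ : ℝ in 𝓝 0, 16 * ρ ^ 2 < 1 / t :=
      ContinuousAt.eventually_lt (by fun_prop) continuousAt_const (by simpa using ht)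
    have e4 : ∀ᶠ ρ : ℝ in 𝓝 0, (2 * n + 8) * ρ ^ 2 + 2 * ρ * C < 1 / (2 * t) :=
      ContinuousAt.eventually_lt (by fun_prop) continuousAt_const (by simpa using ht)
    have e : ∀ᶠ ρ : ℝ in 𝓝[>] 0, _ := nhdsWithin_le_nhds (e1.and (e2.and (e3.and e4)))
    obtain ⟨ρ, ⟨h1, h2, h3, h4⟩, h5⟩ := (e.and self_mem_nhdsWithin).exists
    exact ⟨ρ, h1, h2, h3, h4, h5⟩
  set S : Set (E × ℝ) := Metric.closedBall 0 (1 / ρ) ×ˢ Set.Icc 0 t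
  have hSmem : ∀ (y : E) (s : ℝ), ρ * ‖y‖ ≤ 1 → 0 ≤ s → s ≤ t → (y, s) ∈ S := by
    intro y s hy hs hst
    refine ⟨?_, hs, hst⟩
    rw [mem_closedBall_zero_iff, le_div_iff₀ hρ]
    linarith
  have hxS : (x, t) ∈ S := hSmem x t hρx.le ht.le le_rfl
  have hcont : ContinuousOn (fun p : E × ℝ => p.2 * (1 - ρ ^ 2 * ‖p.1‖ ^ 2) ^ 2 * w p) S := by
    rintro ⟨y, s⟩ ⟨-, hs, -⟩
    have hw' : ContinuousAt w (y, s) := by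
      have h : ∀ i, ContinuousAt (dirDeriv (coordDir i) G) (y, s) := fun i =>
        ((hG y s hs).self_of_nhds.dirDeriv (coordDir i)).continuousAt
      exact tendsto_finsetSum _ fun i _ => (h i).pow 2
    exact ((by fun_prop : ContinuousAt (fun p : E × ℝ => p.2 * (1 - ρ ^ 2 * ‖p.1‖ ^ 2) ^ 2)
      (y, s)).mul hw').continuousWithinAt
  obtain ⟨⟨x₁, t₁⟩, ⟨hx₁, ht₁0, ht₁t⟩, hmax⟩ := ((isCompact_closedBall (0 : E) (1 / ρ)).prod
    (isCompact_Icc (a := (0 : ℝ)) (b := t))).exists_isMaxOn ⟨_, hxS⟩ hcont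
  have hbig : 1 + (2 * K + B) * t < t₁ * (1 - ρ ^ 2 * ‖x₁‖ ^ 2) ^ 2 * w (x₁, t₁) :=
    hρw.trans_le (hmax hxS)
  have hKB : 0 ≤ (2 * K + B) * t := by positivity
  have ht₁ : 0 < t₁ := by
    refine lt_of_le_of_ne ht₁0 fun h => ?_
    rw [← h] at hbig
    simp only [zero_mul] at hbig
    linarith
  have hw₁nn : 0 ≤ w (x₁, t₁) := Finset.sum_nonneg fun i _ => sq_nonneg _
  have hw₁ : 0 < w (x₁, t₁) := by
    refine lt_of_le_of_ne hw₁nn fun h => ?_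
    rw [← h] at hbig
    simp only [mul_zero] at hbig
    linarith
  have hρx₁ : ρ * ‖x₁‖ < 1 := by
    have h1 : ρ * ‖x₁‖ ≤ 1 := by
      have h2 : ‖x₁‖ ≤ 1 / ρ := mem_closedBall_zero_iff.mp hx₁
      rw [le_div_iff₀ hρ] at h2
      linarith
    refine lt_of_le_of_ne h1 fun h => ?_
    rw [← mul_pow, h] at hbig
    norm_num at hbig
    linarith
  obtain ⟨hz, hineq⟩ := max_point_inequality hφ hK hC hρ hHess hdrift ht₁ hρx₁
    (hG x₁ t₁ ht₁.le) (hGnn x₁ t₁ ht₁.le) (hc x₁ t₁ ht₁.le) (hcB x₁ t₁ ht₁.le)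
    (fun y => heq y t₁ ht₁.le)
    (fun y s hy hs hst => hmax (hSmem y s hy hs (hst.trans ht₁t)))
    (Real.sqrt_pos.mpr hw₁) (Real.sq_sqrt hw₁nn) rfl
  have hL1 : 1 ≤ Real.exp (G (x₁, t₁)) := Real.one_le_exp (hGnn x₁ t₁ ht₁.le)
  set z := (1 - ρ ^ 2 * ‖x₁‖ ^ 2) * Real.sqrt (w (x₁, t₁)) with hzdef
  have hz2 : z ^ 2 = (1 - ρ ^ 2 * ‖x₁‖ ^ 2) ^ 2 * w (x₁, t₁) := by
    rw [hzdef, mul_pow, Real.sq_sqrt hw₁nn]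
  have hzbig : 1 / t₁ + 2 * K + B < z ^ 2 := by
    have h1 : (2 * K + B) * t₁ ≤ (2 * K + B) * t :=
      mul_le_mul_of_nonneg_left ht₁t (by positivity)
    have h2 : t₁ * (1 / t₁ + 2 * K + B) < t₁ * z ^ 2 := by
      have h3 : t₁ * (1 / t₁ + 2 * K + B) = 1 + (2 * K + B) * t₁ := by field_simp; ring
      rw [h3, hz2]
      linarith
    exact lt_of_mul_lt_mul_left h2 ht₁.le
  have hinv : 1 / t ≤ 1 / t₁ := one_div_le_one_div_of_le ht₁ ht₁t
  have hρz : 4 * ρ < z := by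
    refine lt_of_pow_lt_pow_left₀ 2 hz.le ?_
    linarith
  set L := Real.exp (G (x₁, t₁))
  have h1 : 0 ≤ (L - 1) * z ^ 3 * (z - 4 * ρ) :=
    mul_nonneg (mul_nonneg (by linarith) (by positivity)) (by linarith)
  have hhalf : ∀ s : ℝ, 1 / (2 * s) = 1 / s / 2 := fun s => by
    rw [mul_comm, ← div_div]
  rw [hhalf] at hineq hρδ
  have hτ : 0 < 1 / t₁ := by positivity
  set δ := (2 * n + 8) * ρ ^ 2 + 2 * ρ * C
  have h2 : z ^ 2 * (1 / t₁ / 2 + K + δ) ≤ z ^ 2 * ((z ^ 2 - B) / 2 + 1 / t₁ / 2) :=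
    mul_le_mul_of_nonneg_left (by linarith) (by positivity)
  have h3 : 1 / t₁ * (z ^ 2 + 2 * B) < (z ^ 2 - B) * (z ^ 2 + 2 * B) :=
    mul_lt_mul_of_pos_right (by linarith) (by positivity)
  have h4 : 0 ≤ 1 / t₁ * B := by positivity
  linarith

theorem dirDeriv_log_one_sub_log {X : Type*} [NormedAddCommGroup X] [NormedSpace ℝ X]
    {U : X → ℝ} {p : X} (hU : DifferentiableAt ℝ U p) (h0 : 0 < U p)
    (h1 : 0 < 1 - Real.log (U p)) (v : X) :
    dirDeriv v (fun p => Real.log (1 - Real.log (U p))) p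
      = -(dirDeriv v U p / (U p * (1 - Real.log (U p)))) := by
  have h := ((hU.hasFDerivAt.log h0.ne').const_sub 1).log h1.ne'
  unfold dirDeriv
  rw [h.fderiv]
  simp
  field_simp

theorem dirDeriv_dirDeriv_log_one_sub_log {X : Type*} [NormedAddCommGroup X] [NormedSpace ℝ X]
    {U : X → ℝ} (hU : ContDiff ℝ ∞ U) {p : X} (h0 : 0 < U p)
    (h1 : 0 < 1 - Real.log (U p)) (v : X) :
    dirDeriv v (dirDeriv v (fun p => Real.log (1 - Real.log (U p)))) p
      = -(dirDeriv v (dirDeriv v U) p / (U p * (1 - Real.log (U p))))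
        - Real.log (U p) * dirDeriv v (fun p => Real.log (1 - Real.log (U p))) p ^ 2 := by
  have hUd : Differentiable ℝ U := hU.differentiable (by simp)
  have hlog : ContinuousAt (fun p => 1 - Real.log (U p)) p :=
    continuousAt_const.sub (hUd.continuous.continuousAt.log h0.ne')
  have hev : dirDeriv v (fun p => Real.log (1 - Real.log (U p))) =ᶠ[𝓝 p]
      fun y => -(dirDeriv v U y / (U y * (1 - Real.log (U y)))) := by
    filter_upwards [hUd.continuous.continuousAt.eventually (lt_mem_nhds h0),
      hlog.eventually (lt_mem_nhds h1)] with y hy0 hy1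
      using dirDeriv_log_one_sub_log (hUd y) hy0 hy1 v
  rw [dirDeriv_log_one_sub_log (hUd p) h0 h1]
  have hnum := hasDerivAt_line_zero v ((hU.contDiffAt.dirDeriv v).differentiableAt
    (x := p) (by simp))
  have hUl := hasDerivAt_line_zero v (hUd p)
  have hU0 : U (p + (0 : ℝ) • v) = U p := by simp
  have hden := hUl.mul ((hUl.log (by rw [hU0]; exact h0.ne')).const_sub 1)
  have hdiv := (hnum.div hden (by simp [h0.ne', h1.ne'])).neg
  have hline : HasDerivAt (fun s : ℝ => dirDeriv v (fun p => Real.log (1 - Real.log (U p)))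
      (p + s • v)) (dirDeriv v (dirDeriv v (fun p => Real.log (1 - Real.log (U p)))) p) 0 := by
    refine hasDerivAt_line_zero v (hev.differentiableAt_iff.mpr ?_)
    simp only [div_eq_mul_inv]
    refine (((hU.contDiffAt.dirDeriv v).differentiableAt (by simp)).fun_mul
      (((hUd p).fun_mul (((hUd p).log h0.ne').const_sub 1)).fun_inv ?_)).fun_neg
    exact (mul_pos h0 h1).ne'
  have huniq := hline.unique (hdiv.congr_of_eventuallyEq (eventually_line v hev))
  rw [huniq]
  simp only [zero_smul, add_zero, Pi.mul_apply]
  field_simp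
  ring

theorem lap_slice {U : E × ℝ → ℝ} (hU : ContDiff ℝ ∞ U) (x : E) (t : ℝ) :
    lap (fun y => U (y, t)) x = ∑ i, dirDeriv (coordDir i) (dirDeriv (coordDir i) U) (x, t) := by
  refine Finset.sum_congr rfl fun i _ => ?_
  have h : (fun y => fderiv ℝ (fun z => U (z, t)) y (EuclideanSpace.single i 1))
      = fun y => dirDeriv (coordDir i) U (y, t) :=
    funext fun y => fderiv_slice (hU.contDiffAt.differentiableAt (by simp)) _
  rw [h]
  exact fderiv_slice ((hU.contDiffAt.dirDeriv _).differentiableAt (by simp)) _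

/-- The equation satisfied by `log (1 - log U)` when `U` solves `∂ₜU = ΔU + ⟨∇φ, ∇U⟩ + b U`. -/
theorem log_one_sub_log_equation {U : E × ℝ → ℝ} (hU : ContDiff ℝ ∞ U) {φ : E → ℝ} {b : ℝ}
    {x : E} {t : ℝ} (h0 : 0 < U (x, t)) (h1 : 0 < 1 - Real.log (U (x, t)))
    (heq : dirDeriv (0, 1) U (x, t) =
      ∑ i, dirDeriv (coordDir i) (dirDeriv (coordDir i) U) (x, t)
      + ∑ i, dirDeriv (EuclideanSpace.single i 1) φ x * dirDeriv (coordDir i) U (x, t)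
      + b * U (x, t))
    {G : E × ℝ → ℝ} (hG : G = fun p => Real.log (1 - Real.log (U p))) :
    dirDeriv (0, 1) G (x, t) =
      ∑ i, dirDeriv (coordDir i) (dirDeriv (coordDir i) G) (x, t)
      + ∑ i, dirDeriv (EuclideanSpace.single i 1) φ x * dirDeriv (coordDir i) G (x, t)
      + (1 - Real.exp (G (x, t))) * ∑ i, (dirDeriv (coordDir i) G (x, t)) ^ 2
      + -b * Real.exp (-G (x, t)) := by
  have hUd : DifferentiableAt ℝ U (x, t) := hU.contDiffAt.differentiableAt (by simp)
  have hD : ∀ v, dirDeriv v G (x, t)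
      = -(dirDeriv v U (x, t) / (U (x, t) * (1 - Real.log (U (x, t))))) := fun v => by
    rw [hG, dirDeriv_log_one_sub_log hUd h0 h1]
  have hDD : ∀ i, dirDeriv (coordDir i) (dirDeriv (coordDir i) G) (x, t)
      = -(dirDeriv (coordDir i) (dirDeriv (coordDir i) U) (x, t)
          / (U (x, t) * (1 - Real.log (U (x, t)))))
        - Real.log (U (x, t)) * dirDeriv (coordDir i) G (x, t) ^ 2 := fun i => by
    rw [hG, dirDeriv_dirDeriv_log_one_sub_log hU h0 h1]
  have hexp : Real.exp (G (x, t)) = 1 - Real.log (U (x, t)) := by rw [hG, Real.exp_log h1]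
  have hS2 : ∑ i, dirDeriv (EuclideanSpace.single i 1) φ x * dirDeriv (coordDir i) G (x, t)
      = -((∑ i, dirDeriv (EuclideanSpace.single i 1) φ x * dirDeriv (coordDir i) U (x, t))
          / (U (x, t) * (1 - Real.log (U (x, t))))) := by
    rw [Finset.sum_div, ← Finset.sum_neg_distrib]
    refine Finset.sum_congr rfl fun i _ => ?_
    rw [hD]; ring
  rw [hS2, hD, heq, Real.exp_neg, hexp]
  simp only [hDD]
  rw [Finset.sum_sub_distrib, Finset.sum_neg_distrib, ← Finset.sum_div, ← Finset.mul_sum]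
  field_simp
  ring

end Euclidean

/-- **Ruan-type gradient estimate** (Euclidean instance of the corollary recovering Ruan's
theorem): for `V = ∇φ` with `Hess φ(ξ,ξ) + (1/N)⟨∇φ, ξ⟩² ≤ K|ξ|²`, `b < 0` differentiable in
space with `|∇√(-b)| ≤ B` everywhere, and `0 < u ≤ 1` a solution of
`u_t = Δu + ⟨∇φ, ∇u⟩ + b u`, one has
`|∇u|/u ≤ (t^{-1/2} + √(2K) + B^{1/2})(1 - log u)`. -/
theorem gradient_estimate_Ruan {n : ℕ} (N : ℕ) (hN : 0 < N)
    (φ : EuclideanSpace ℝ (Fin n) → ℝ) (hφ : ContDiff ℝ ∞ φ)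
    (K : ℝ) (hK : 0 ≤ K)
    (hRic : ∀ x ξ : EuclideanSpace ℝ (Fin n),
      fderiv ℝ (fun y => fderiv ℝ φ y ξ) x ξ + (1 / (N : ℝ)) * ⟪gradient φ x, ξ⟫ ^ 2
        ≤ K * ‖ξ‖ ^ 2)
    (b : EuclideanSpace ℝ (Fin n) → ℝ → ℝ)
    (hb_neg : ∀ x t, 0 ≤ t → b x t < 0)
    (hb_diff : ∀ t, 0 ≤ t → Differentiable ℝ (fun x => b x t))
    (B : ℝ) (hB : 0 ≤ B)
    (hBsup : ∀ x t, 0 ≤ t →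
      ‖gradient (fun y => Real.sqrt (-(b y t))) x‖ ≤ B)
    (u : EuclideanSpace ℝ (Fin n) → ℝ → ℝ)
    (hu_smooth : ContDiff ℝ ∞ (fun p : EuclideanSpace ℝ (Fin n) × ℝ => u p.1 p.2))
    (hu_pos : ∀ x t, 0 ≤ t → 0 < u x t)
    (hu_le : ∀ x t, 0 ≤ t → u x t ≤ 1)
    (heq : ∀ x t, 0 ≤ t →
      deriv (u x) t = lap (fun y => u y t) x + ⟪gradient φ x, gradient (fun y => u y t) x⟫
        + b x t * u x t) :
    ∀ x t, 0 < t →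
      ‖gradient (fun y => u y t) x‖ / u x t
        ≤ (1 / Real.sqrt t + Real.sqrt (2 * K) + Real.sqrt B) * (1 - Real.log (u x t)) := by
  intro x t ht
  set U : EuclideanSpace ℝ (Fin n) × ℝ → ℝ := fun p => u p.1 p.2 with hUdef
  set G : EuclideanSpace ℝ (Fin n) × ℝ → ℝ := fun p => Real.log (1 - Real.log (U p))
  have hUd : ∀ p, DifferentiableAt ℝ U p := fun p =>
    hu_smooth.contDiffAt.differentiableAt (by simp)
  have hℓ : ∀ y s, 0 ≤ s → 1 ≤ 1 - Real.log (U (y, s)) := fun y s hs => by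
    have := Real.log_nonpos (hu_pos y s hs).le (hu_le y s hs)
    simp only [hUdef]
    linarith
  have hgradU : ∀ y s i, gradient (fun z => u z s) y i = dirDeriv (coordDir i) U (y, s) :=
    fun y s i => (gradient_apply i).trans (fderiv_slice (hUd (y, s)) _)
  have hGsm : ∀ y s, 0 ≤ s → ∀ᶠ p in 𝓝 (y, s), ContDiffAt ℝ ∞ G p := by
    intro y s hs
    have hc := (hUd (y, s)).continuousAt
    have h0 : 0 < U (y, s) := hu_pos y s hs
    filter_upwards [hc.eventually (lt_mem_nhds h0),
      (continuousAt_const.sub (hc.log h0.ne')).eventually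
        (lt_mem_nhds (zero_lt_one.trans_le (hℓ y s hs)))] with p hp0 hp1
    exact (contDiffAt_const.sub (hu_smooth.contDiffAt.log hp0.ne')).log hp1.ne'
  have hinner : ∀ y s, ⟪gradient φ y, gradient (fun z => u z s) y⟫
      = ∑ i, dirDeriv (EuclideanSpace.single i 1) φ y * dirDeriv (coordDir i) U (y, s) := by
    intro y s
    rw [inner_gradient_eq_fderiv]
    refine (dirDeriv_eq_sum φ _ y).trans (Finset.sum_congr rfl fun i _ => ?_)
    rw [hgradU, mul_comm]
  have hGeq : ∀ y s, 0 ≤ s → dirDeriv (0, 1) G (y, s) =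
      ∑ i, dirDeriv (coordDir i) (dirDeriv (coordDir i) G) (y, s)
      + ∑ i, dirDeriv (EuclideanSpace.single i 1) φ y * dirDeriv (coordDir i) G (y, s)
      + (1 - Real.exp (G (y, s))) * ∑ i, (dirDeriv (coordDir i) G (y, s)) ^ 2
      + Real.sqrt (-(b y s)) ^ 2 * Real.exp (-G (y, s)) := by
    intro y s hs
    rw [Real.sq_sqrt (by linarith [hb_neg y s hs])]
    refine log_one_sub_log_equation hu_smooth (hu_pos y s hs)
      (zero_lt_one.trans_le (hℓ y s hs)) ?_ rfl
    have h := heq y s hs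
    rw [hinner] at h
    rw [← (hasDerivAt_time (hUd (y, s))).deriv, ← lap_slice hu_smooth]
    exact h
  obtain ⟨C, hC, hdrift⟩ := exists_radial_fderiv_le N hN φ hφ K hRic
  have hHess : ∀ y ξ, dirDeriv ξ (dirDeriv ξ φ) y ≤ K * ‖ξ‖ ^ 2 := fun y ξ => by
    have h1 : 0 ≤ (1 / (N : ℝ)) * ⟪gradient φ y, ξ⟫ ^ 2 := by positivity
    exact (le_add_of_nonneg_right h1).trans (hRic y ξ)
  have hmain := sum_sq_dirDeriv_le (c := fun y s => Real.sqrt (-(b y s))) hφ hK hB hC hHess hdrift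
    hGsm (fun y s hs => Real.log_nonneg (hℓ y s hs))
    (fun y s hs => (hb_diff s hs y).fun_neg.sqrt (neg_pos.mpr (hb_neg y s hs)).ne')
    (fun y s hs ξ => by
      rw [dirDeriv, ← inner_gradient_eq_fderiv]
      exact (abs_real_inner_le_norm _ _).trans
        (mul_le_mul_of_nonneg_right (hBsup y s hs) (norm_nonneg ξ)))
    hGeq x ht
  have hu0 : 0 < u x t := hu_pos x t ht.le
  have hℓ0 : 0 < 1 - Real.log (u x t) := zero_lt_one.trans_le (hℓ x t ht.le)
  have hnorm : ‖gradient (fun y => u y t) x‖ ^ 2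
      = (u x t * (1 - Real.log (u x t))) ^ 2 * ∑ i, dirDeriv (coordDir i) G (x, t) ^ 2 := by
    rw [EuclideanSpace.norm_sq_eq, Finset.mul_sum]
    refine Finset.sum_congr rfl fun i _ => ?_
    rw [Real.norm_eq_abs, sq_abs, hgradU, dirDeriv_log_one_sub_log (hUd (x, t)) hu0 hℓ0]
    simp only [hUdef]
    field_simp
  set A := 1 / Real.sqrt t + Real.sqrt (2 * K) + Real.sqrt B with hA
  have hA0 : 0 ≤ A := by positivity
  have hAsq : 1 / t + 2 * K + B ≤ A ^ 2 := by
    have h1 : (1 / Real.sqrt t) ^ 2 = 1 / t := by rw [div_pow, Real.sq_sqrt ht.le, one_pow]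
    have h2 := Real.sq_sqrt (by positivity : 0 ≤ 2 * K)
    have h3 := Real.sq_sqrt hB
    have h4 : 0 ≤ 1 / Real.sqrt t * Real.sqrt (2 * K) := by positivity
    have h5 : 0 ≤ 1 / Real.sqrt t * Real.sqrt B := by positivity
    have h6 : 0 ≤ Real.sqrt (2 * K) * Real.sqrt B := by positivity
    rw [hA]
    linarith
  rw [div_le_iff₀ hu0]
  refine le_of_abs_le (abs_le_of_sq_le_sq ?_ (by positivity))
  rw [hnorm]
  calc _ ≤ (u x t * (1 - Real.log (u x t))) ^ 2 * A ^ 2 :=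
        mul_le_mul_of_nonneg_left (hmain.trans hAsq) (sq_nonneg _)
    _ = _ := by ring
end

section
/- Let a < 0 be a real constant and let u : ℝⁿ → ℝ be a smooth, positive, bounded solution of Δu + a·u·log u = 0 on ℝⁿ. Then u is identically equal to 1. -/
open scoped RealInnerProductSpace ContDiff

/-- The second derivative is nonnegative at a local minimum. -/
theorem IsLocalMin.deriv_deriv_nonneg {f : ℝ → ℝ} {x : ℝ} (h : IsLocalMin f x)
    (hf : ContinuousAt f x) : 0 ≤ deriv (deriv f) x := by
  by_contra! hneg
  have hmax : IsLocalMax f x := isLocalMax_of_deriv_deriv_neg hneg h.deriv_eq_zero hf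
  have hconst : f =ᶠ[nhds x] fun _ => f x := by
    filter_upwards [h, hmax] with y hy hy' using le_antisymm hy' hy
  have h2 := hconst.deriv.deriv_eq
  simp at h2
  exact hneg.ne h2

section Laplacian

variable {n : ℕ}

theorem lap_eq_sum_deriv_deriv {f : EuclideanSpace ℝ (Fin n) → ℝ} (hf : ContDiff ℝ 2 f)
    (x : EuclideanSpace ℝ (Fin n)) :
    lap f x = ∑ i : Fin n,
      deriv (deriv fun t : ℝ => f (x + t • EuclideanSpace.single i (1 : ℝ))) 0 := by
  refine Finset.sum_congr rfl fun i _ => ?_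
  have along (g : EuclideanSpace ℝ (Fin n) → ℝ) (hg : Differentiable ℝ g) (t : ℝ) :
      deriv (fun t : ℝ => g (x + t • EuclideanSpace.single i (1 : ℝ))) t =
        fderiv ℝ g (x + t • EuclideanSpace.single i (1 : ℝ)) (EuclideanSpace.single i 1) := by
    have hl : HasDerivAt (fun t : ℝ => x + t • EuclideanSpace.single i (1 : ℝ))
        (EuclideanSpace.single i (1 : ℝ)) t := by
      simpa using ((hasDerivAt_id t).smul_const (EuclideanSpace.single i (1 : ℝ))).const_add x
    exact ((hg _).hasFDerivAt.comp_hasDerivAt t hl).deriv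
  have hf' : Differentiable ℝ fun y => fderiv ℝ f y (EuclideanSpace.single i 1) :=
    ((hf.fderiv_right (m := 1) (by norm_num)).clm_apply contDiff_const).differentiable
      (by norm_num)
  rw [funext (along f (hf.differentiable (by norm_num))), along _ hf']
  simp

/-- If `g` touches `f` from below at `x`, then `lap g x ≤ lap f x`. -/
theorem lap_le_lap_of_isLocalMin_sub {f g : EuclideanSpace ℝ (Fin n) → ℝ}
    (hf : ContDiff ℝ 2 f) (hg : ContDiff ℝ 2 g) {x : EuclideanSpace ℝ (Fin n)}
    (h : IsLocalMin (fun y => f y - g y) x) : lap g x ≤ lap f x := by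
  rw [lap_eq_sum_deriv_deriv hf, lap_eq_sum_deriv_deriv hg]
  refine Finset.sum_le_sum fun i _ => ?_
  set l : ℝ → EuclideanSpace ℝ (Fin n) := fun t => x + t • EuclideanSpace.single i (1 : ℝ)
    with hl_def
  have hl : ContDiff ℝ 2 l := by fun_prop
  have hF : ContDiff ℝ 2 fun t => f (l t) := hf.comp hl
  have hG : ContDiff ℝ 2 fun t => g (l t) := hg.comp hl
  have hmin : IsLocalMin (fun t => f (l t) - g (l t)) 0 := by
    have hl0 : l 0 = x := by simp [hl_def]
    have htend : Filter.Tendsto l (nhds 0) (nhds x) := by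
      simpa [hl0] using hl.continuous.tendsto 0
    have := htend.eventually h
    simpa [IsLocalMin, IsMinFilter, hl0] using this
  have key := hmin.deriv_deriv_nonneg (hF.continuous.sub hG.continuous).continuousAt
  have hd : deriv (fun t => f (l t) - g (l t)) =
      fun t => deriv (fun t => f (l t)) t - deriv (fun t => g (l t)) t :=
    funext fun t => deriv_fun_sub (hF.differentiable (by norm_num) t)
      (hG.differentiable (by norm_num) t)
  have hdF : Differentiable ℝ (deriv fun t => f (l t)) :=
    (contDiff_succ_iff_deriv (n := 1).1 hF).2.2.differentiable (by norm_num)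
  have hdG : Differentiable ℝ (deriv fun t => g (l t)) :=
    (contDiff_succ_iff_deriv (n := 1).1 hG).2.2.differentiable (by norm_num)
  rw [hd, deriv_fun_sub (hdF 0) (hdG 0)] at key
  linarith

theorem lap_neg (f : EuclideanSpace ℝ (Fin n) → ℝ) (x : EuclideanSpace ℝ (Fin n)) :
    lap (fun y => -f y) x = -lap f x := by
  simp [lap, fderiv_fun_neg, Finset.sum_neg_distrib]

theorem norm_add_smul_single_sq (x : EuclideanSpace ℝ (Fin n)) (i : Fin n) (t : ℝ) :
    ‖x + t • EuclideanSpace.single i (1 : ℝ)‖ ^ 2 = ‖x‖ ^ 2 + 2 * x i * t + t ^ 2 := by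
  rw [norm_add_sq_real, inner_smul_right, norm_smul]
  simp [EuclideanSpace.inner_single_right]
  ring

theorem lap_const_mul_norm_sq (c : ℝ) (x : EuclideanSpace ℝ (Fin n)) :
    lap (fun y => c * ‖y‖ ^ 2) x = 2 * n * c := by
  rw [lap_eq_sum_deriv_deriv (contDiff_const.mul (contDiff_norm_sq ℝ))]
  simp only [norm_add_smul_single_sq]
  have (i : Fin n) : deriv (deriv fun t : ℝ => c * (‖x‖ ^ 2 + 2 * x i * t + t ^ 2)) 0 =
      2 * c := by
    have h1 : (deriv fun t : ℝ => c * (‖x‖ ^ 2 + 2 * x i * t + t ^ 2)) =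
        fun t => c * (2 * x i + 2 * t) := by
      funext t
      have := ((((hasDerivAt_id t).const_mul (2 * x i)).const_add (‖x‖ ^ 2)).add
        ((hasDerivAt_id t).pow 2)).const_mul c
      refine (this.congr_deriv ?_).deriv
      simp
    rw [h1]
    have := (((hasDerivAt_id (0 : ℝ)).const_mul 2).const_add (2 * x i)).const_mul c
    refine (this.congr_deriv ?_).deriv
    ring
  simp only [this]
  simp
  ring

theorem lap_const_mul_one_sub_norm_sq_sq (c : ℝ) (x : EuclideanSpace ℝ (Fin n)) :
    lap (fun y => c * (1 - ‖y‖ ^ 2) ^ 2) x =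
      c * (8 * ‖x‖ ^ 2 - 4 * n * (1 - ‖x‖ ^ 2)) := by
  rw [lap_eq_sum_deriv_deriv
    (contDiff_const.mul ((contDiff_const.sub (contDiff_norm_sq ℝ)).pow 2))]
  simp only [norm_add_smul_single_sq]
  have (i : Fin n) :
      deriv (deriv fun t : ℝ => c * (1 - (‖x‖ ^ 2 + 2 * x i * t + t ^ 2)) ^ 2) 0 =
        c * (8 * x i ^ 2 - 4 * (1 - ‖x‖ ^ 2)) := by
    have hp (t : ℝ) : HasDerivAt (fun t : ℝ => 1 - (‖x‖ ^ 2 + 2 * x i * t + t ^ 2))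
        (-(2 * x i + 2 * t)) t := by
      have := ((((hasDerivAt_id t).const_mul (2 * x i)).const_add (‖x‖ ^ 2)).add
        ((hasDerivAt_id t).pow 2)).const_sub 1
      refine this.congr_deriv ?_
      simp
    have h1 : (deriv fun t : ℝ => c * (1 - (‖x‖ ^ 2 + 2 * x i * t + t ^ 2)) ^ 2) =
        fun t => c * (2 * (1 - (‖x‖ ^ 2 + 2 * x i * t + t ^ 2)) * -(2 * x i + 2 * t)) := by
      funext t
      refine ((((hp t).pow 2).const_mul c).congr_deriv ?_).deriv
      simp
    rw [h1]
    have hq : HasDerivAt (fun t : ℝ => -(2 * x i + 2 * t)) (-2) 0 := by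
      refine ((((hasDerivAt_id (0 : ℝ)).const_mul 2).const_add (2 * x i)).neg).congr_deriv ?_
      ring
    refine (((((hp 0).const_mul 2).mul hq).const_mul c).congr_deriv ?_).deriv
    ring
  simp only [this]
  rw [← Finset.mul_sum, Finset.sum_sub_distrib, ← Finset.mul_sum, EuclideanSpace.real_norm_sq_eq]
  simp only [Finset.sum_const, Finset.card_univ, Fintype.card_fin, nsmul_eq_mul]
  ring

/-- A weak maximum principle at infinity on `ℝⁿ` for functions bounded below. -/
theorem exists_le_add_and_neg_le_lap {h : EuclideanSpace ℝ (Fin n) → ℝ} (hh : ContDiff ℝ 2 h)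
    {m : ℝ} (hm : ∀ x, m ≤ h x) (x₀ : EuclideanSpace ℝ (Fin n)) {η : ℝ} (hη : 0 < η) :
    ∃ x, h x ≤ h x₀ + η ∧ -η ≤ lap h x := by
  set ε : ℝ := η / (‖x₀‖ ^ 2 + 2 * n + 1) with hε_def
  have hD : 0 < ‖x₀‖ ^ 2 + 2 * n + 1 := by positivity
  have hε : 0 < ε := by positivity
  have hεη : ε * (‖x₀‖ ^ 2 + 2 * n + 1) = η := div_mul_cancel₀ _ hD.ne'
  have htend : Filter.Tendsto (fun x => h x + ε * ‖x‖ ^ 2) (Filter.cocompact _) Filter.atTop :=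
    Filter.tendsto_atTop_add_left_of_le _ m hm
      (((Filter.tendsto_pow_atTop two_ne_zero).comp
        (tendsto_norm_cocompact_atTop (E := EuclideanSpace ℝ (Fin n)))).const_mul_atTop hε)
  have hcont : Continuous fun x => h x + ε * ‖x‖ ^ 2 :=
    hh.continuous.add (continuous_const.mul (continuous_norm.pow 2))
  obtain ⟨x, hx⟩ := hcont.exists_forall_le htend
  refine ⟨x, ?_, ?_⟩
  · have h0 := hx x₀
    have : 0 ≤ ε * ‖x‖ ^ 2 := by positivity
    have : 0 ≤ ε * n := by positivity
    nlinarith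
  · have hmin : IsLocalMin (fun y => h y - (-ε) * ‖y‖ ^ 2) x :=
      Filter.Eventually.of_forall fun y => by simpa using hx y
    have := lap_le_lap_of_isLocalMin_sub hh (contDiff_const.mul (contDiff_norm_sq ℝ)) hmin
    rw [lap_const_mul_norm_sq] at this
    have : 0 ≤ ε * ‖x₀‖ ^ 2 := by positivity
    nlinarith

theorem lap_comp_add_right (f : EuclideanSpace ℝ (Fin n) → ℝ) (z x : EuclideanSpace ℝ (Fin n)) :
    lap (fun y => f (y + z)) x = lap f (x + z) := by
  simp only [lap, fderiv_comp_add_right]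
  refine Finset.sum_congr rfl fun i _ => ?_
  rw [fderiv_comp_add_right (f := fun y => fderiv ℝ f y (EuclideanSpace.single i 1))]

/-- A positive solution of `Δu = b u log u` with `b > 0` is bounded below at the origin by a
positive constant depending only on `b` and the dimension. -/
theorem exp_neg_le_of_lap_eq_mul_log {b : ℝ} (hb : 0 < b) {u : EuclideanSpace ℝ (Fin n) → ℝ}
    (hu : ContDiff ℝ 2 u) (hpos : ∀ x, 0 < u x)
    (heq : ∀ x, lap u x = b * u x * Real.log (u x)) :
    Real.exp (-((8 + 4 * n) ^ 2 / (16 * b))) ≤ u 0 := by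
  set L : ℝ := (8 + 4 * n) ^ 2 / (16 * b) with hL_def
  have hbL : 16 * (b * L) = (8 + 4 * n) ^ 2 := by rw [hL_def]; field_simp
  set φ : EuclideanSpace ℝ (Fin n) → ℝ := fun y => (1 - ‖y‖ ^ 2) ^ 2 / u y with hφ_def
  have hφ : Continuous φ := Continuous.div (by fun_prop) hu.continuous fun y => (hpos y).ne'
  obtain ⟨x, hxB, hx⟩ := (isCompact_closedBall (0 : EuclideanSpace ℝ (Fin n)) 1).exists_isMaxOn
    ⟨0, by simp⟩ hφ.continuousOn
  have hφ0 : φ 0 = 1 / u 0 := by simp [hφ_def]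
  have hφx : 1 / u 0 ≤ φ x := hφ0 ▸ hx (by simp)
  have hφx_pos : 0 < φ x := (one_div_pos.2 (hpos 0)).trans_le hφx
  have hx1 : ‖x‖ ≤ 1 := by simpa using hxB
  have hxlt : ‖x‖ < 1 := by
    refine lt_of_le_of_ne hx1 fun h => ?_
    simp [hφ_def, h] at hφx_pos
  have hq : 0 < 1 - ‖x‖ ^ 2 := by nlinarith [norm_nonneg x]
  have hq1 : 1 - ‖x‖ ^ 2 ≤ 1 := by nlinarith [norm_nonneg x]
  set s : ℝ := (φ x)⁻¹ with hs_def
  have hs : 0 < s := inv_pos.2 hφx_pos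
  have hs0 : s ≤ u 0 := by
    rw [hs_def, inv_le_comm₀ hφx_pos (hpos 0)]
    simpa using hφx
  refine le_trans ?_ hs0
  by_contra! hlt
  have hux : u x = s * (1 - ‖x‖ ^ 2) ^ 2 := by
    have := (hpos x).ne'
    rw [hs_def, hφ_def]
    field_simp
  have hmin : IsLocalMin (fun y => u y - s * (1 - ‖y‖ ^ 2) ^ 2) x := by
    filter_upwards [Metric.isOpen_ball.mem_nhds (show x ∈ Metric.ball 0 1 by simpa using hxlt)]
      with y hy
    have hy' : φ y ≤ φ x := hx (Metric.ball_subset_closedBall hy)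
    have h1 : s * φ y ≤ 1 := by
      rw [hs_def, inv_mul_le_iff₀ hφx_pos]
      simpa using hy'
    have h2 : s * (1 - ‖y‖ ^ 2) ^ 2 = s * φ y * u y := by
      have := (hpos y).ne'
      rw [hφ_def]
      field_simp
    have h3 := mul_le_mul_of_nonneg_right h1 (hpos y).le
    simp only [hux]
    linarith
  have key := lap_le_lap_of_isLocalMin_sub hu
    (contDiff_const.mul ((contDiff_const.sub (contDiff_norm_sq ℝ)).pow 2)) hmin
  rw [lap_const_mul_one_sub_norm_sq_sq, heq] at key
  have hlog : Real.log (u x) ≤ -L := by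
    rw [Real.log_le_iff_le_exp (hpos x), hux]
    have : (1 - ‖x‖ ^ 2) ^ 2 ≤ 1 := pow_le_one₀ hq.le hq1
    nlinarith
  have h4 : b * u x * Real.log (u x) ≤ b * u x * -L :=
    mul_le_mul_of_nonneg_left hlog (mul_pos hb (hpos x)).le
  rw [hux] at h4 key
  have h5 : s * (8 * ‖x‖ ^ 2 - 4 * n * (1 - ‖x‖ ^ 2)) ≤ s * (-(b * L) * (1 - ‖x‖ ^ 2) ^ 2) := by
    linarith
  have h6 := le_of_mul_le_mul_left h5 hs
  nlinarith [sq_nonneg ((8 + 4 * n) * (1 - ‖x‖ ^ 2) - 8)]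

end Laplacian

/-- **Huang–Ma Liouville theorem** (Euclidean instance): if `a < 0` is constant and `u` is a
smooth positive bounded solution of `Δu + a u log u = 0` on `ℝⁿ`, then `u ≡ 1`. -/
theorem liouville_huang_ma {n : ℕ} (a : ℝ) (ha : a < 0)
    (u : EuclideanSpace ℝ (Fin n) → ℝ) (hu_smooth : ContDiff ℝ ∞ u)
    (hu_pos : ∀ x, 0 < u x) (hu_bdd : ∃ C : ℝ, ∀ x, u x ≤ C)
    (heq : ∀ x, lap u x + a * u x * Real.log (u x) = 0) :
    ∀ x, u x = 1 := by
  obtain ⟨C, hC⟩ := hu_bdd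
  have hu : ContDiff ℝ 2 u := contDiff_infty.1 hu_smooth 2
  obtain ⟨b, rfl⟩ : ∃ b, a = -b := ⟨-a, by ring⟩
  have hb : 0 < b := by linarith
  have heq' (x) : lap u x = b * u x * Real.log (u x) := by linarith [heq x]
  obtain ⟨δ, hδ, hδu⟩ : ∃ δ > 0, ∀ x, δ ≤ u x := by
    refine ⟨_, Real.exp_pos (-((8 + 4 * n) ^ 2 / (16 * b))), fun x => ?_⟩
    simpa using exp_neg_le_of_lap_eq_mul_log hb (u := fun y => u (y + x))
      (hu.comp (contDiff_id.add contDiff_const)) (fun y => hu_pos _)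
      (fun y => by rw [lap_comp_add_right]; exact heq' _)
  intro x₀
  refine le_antisymm ?_ ?_
  · by_contra! hlt
    set m : ℝ := (1 + u x₀) / 2 with hm_def
    have hm : 1 < m := by linarith
    have hlogm : 0 < Real.log m := Real.log_pos hm
    obtain ⟨x, hx, hlap⟩ := exists_le_add_and_neg_le_lap (h := fun y => -u y) hu.neg
      (m := -C) (fun x => neg_le_neg (hC x)) x₀
      (η := min (m - 1) (b * Real.log m / 2)) (lt_min (by linarith) (by positivity))
    rw [lap_neg, heq'] at hlap
    have h1 := min_le_left (m - 1) (b * Real.log m / 2)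
    have h2 := min_le_right (m - 1) (b * Real.log m / 2)
    have hmx : m ≤ u x := by linarith
    have h3 : Real.log m ≤ Real.log (u x) := Real.log_le_log (by linarith) hmx
    have h4 : 1 * Real.log m ≤ u x * Real.log (u x) :=
      mul_le_mul (by linarith) h3 hlogm.le (hu_pos x).le
    nlinarith [mul_le_mul_of_nonneg_left h4 hb.le, mul_pos hb hlogm]
  · by_contra! hlt
    set m : ℝ := (1 + u x₀) / 2 with hm_def
    have hm : m < 1 := by linarith
    have hm0 : 0 < m := by linarith [hu_pos x₀]
    have hlogm : 0 < -Real.log m := neg_pos.2 (Real.log_neg hm0 hm)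
    obtain ⟨x, hx, hlap⟩ := exists_le_add_and_neg_le_lap hu hδu x₀
      (η := min (1 - m) (b * (δ * -Real.log m) / 2)) (lt_min (by linarith) (by positivity))
    rw [heq'] at hlap
    have h1 := min_le_left (1 - m) (b * (δ * -Real.log m) / 2)
    have h2 := min_le_right (1 - m) (b * (δ * -Real.log m) / 2)
    have hmx : u x ≤ m := by linarith
    have h3 : -Real.log m ≤ -Real.log (u x) := neg_le_neg (Real.log_le_log (hu_pos x) hmx)
    have h4 : δ * -Real.log m ≤ u x * -Real.log (u x) :=
      mul_le_mul (hδu x) h3 hlogm.le (hu_pos x).le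
    nlinarith [mul_le_mul_of_nonneg_left h4 hb.le, mul_pos hb (mul_pos hδ hlogm)]
end

section
/- Let N > 0 be a natural number, K ≥ 0, and V : ℝⁿ → ℝⁿ a smooth vector field satisfying ½⟨(DV(x) + DV(x)ᵀ)ξ, ξ⟩ + (1/N)⟨V(x), ξ⟩² ≤ K|ξ|² for all x, ξ ∈ ℝⁿ. Let a < 0 and b ≤ 0 be real constants with a ≤ −K, and let C ≥ 1. If u : ℝⁿ → ℝ is a smooth positive solution of Δu + ⟨V, ∇u⟩ + a·u·log u + b·u = 0 with u ≤ C, then u is identically equal to the constant e^{−b/a}. -/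
open scoped RealInnerProductSpace ContDiff

namespace EuclideanLiouville

section PartialDerivatives

variable {n : ℕ} {f g : EuclideanSpace ℝ (Fin n) → ℝ} {x : EuclideanSpace ℝ (Fin n)}

/-- The `i`-th partial derivative. -/
noncomputable def pd (i : Fin n) (f : EuclideanSpace ℝ (Fin n) → ℝ)
    (x : EuclideanSpace ℝ (Fin n)) : ℝ :=
  fderiv ℝ f x (EuclideanSpace.single i 1)

lemma lap_eq_sum_pd : lap f x = ∑ i, pd i (pd i f) x := rfl

lemma contDiff_pd (i : Fin n) (hf : ContDiff ℝ ∞ f) : ContDiff ℝ ∞ (pd i f) :=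
  (hf.fderiv_right (m := ∞) (by simp)).clm_apply contDiff_const

lemma differentiableAt_of_smooth (hf : ContDiff ℝ ∞ f) : DifferentiableAt ℝ f x :=
  hf.differentiable (by simp) x

lemma pd_add (i : Fin n) (hf : DifferentiableAt ℝ f x) (hg : DifferentiableAt ℝ g x) :
    pd i (fun y => f y + g y) x = pd i f x + pd i g x := by
  simp [pd, fderiv_fun_add hf hg]

lemma pd_sub (i : Fin n) (hf : DifferentiableAt ℝ f x) (hg : DifferentiableAt ℝ g x) :
    pd i (fun y => f y - g y) x = pd i f x - pd i g x := by
  simp [pd, fderiv_fun_sub hf hg]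

lemma pd_mul (i : Fin n) (hf : DifferentiableAt ℝ f x) (hg : DifferentiableAt ℝ g x) :
    pd i (fun y => f y * g y) x = pd i f x * g x + f x * pd i g x := by
  simp [pd, fderiv_fun_mul hf hg]; ring

lemma pd_const_mul (i : Fin n) (c : ℝ) (hf : DifferentiableAt ℝ f x) :
    pd i (fun y => c * f y) x = c * pd i f x := by
  simp [pd, fderiv_const_mul hf]

lemma pd_sq (i : Fin n) (hf : DifferentiableAt ℝ f x) :
    pd i (fun y => f y ^ 2) x = 2 * f x * pd i f x := by
  simp only [sq]
  rw [pd_mul i hf hf]; ring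

lemma pd_sum {ι : Type*} [Fintype ι] (i : Fin n) {F : ι → EuclideanSpace ℝ (Fin n) → ℝ}
    (hF : ∀ k, DifferentiableAt ℝ (F k) x) :
    pd i (fun y => ∑ k, F k y) x = ∑ k, pd i (F k) x := by
  simp [pd, fderiv_fun_sum (u := Finset.univ) (fun k _ => hF k)]

lemma pd_const (i : Fin n) (c : ℝ) : pd i (fun _ => c) x = 0 := by
  simp [pd]

lemma pd_coord (i : Fin n) : pd i (fun y => y i) x = 1 := by
  have : HasFDerivAt (fun y : EuclideanSpace ℝ (Fin n) => y i)
      (EuclideanSpace.proj i : EuclideanSpace ℝ (Fin n) →L[ℝ] ℝ) x :=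
    (EuclideanSpace.proj i : EuclideanSpace ℝ (Fin n) →L[ℝ] ℝ).hasFDerivAt
  simp [pd, this.fderiv]

lemma pd_norm_sq (i : Fin n) : pd i (fun y => ‖y‖ ^ 2) x = 2 * x i := by
  simp [pd, fderiv_norm_sq_apply, EuclideanSpace.inner_single_right]

lemma contDiff_coord (i : Fin n) :
    ContDiff ℝ ∞ (fun y : EuclideanSpace ℝ (Fin n) => y i) :=
  (EuclideanSpace.proj i : EuclideanSpace ℝ (Fin n) →L[ℝ] ℝ).contDiff

lemma pd_comm (i j : Fin n) (hf : ContDiff ℝ ∞ f) : pd i (pd j f) x = pd j (pd i f) x := by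
  have hs : IsSymmSndFDerivAt ℝ f x :=
    hf.contDiffAt.isSymmSndFDerivAt (by simpa using WithTop.coe_le_coe.2 (le_top (a := (2 : ℕ∞))))
  have hd : DifferentiableAt ℝ (fderiv ℝ f) x :=
    (hf.fderiv_right (m := ∞) (by simp)).differentiable (by simp) x
  have key (v w : EuclideanSpace ℝ (Fin n)) :
      fderiv ℝ (fun y => fderiv ℝ f y v) x w = fderiv ℝ (fderiv ℝ f) x w v := by
    rw [fderiv_clm_apply hd (differentiableAt_const v)]
    simp
  change fderiv ℝ (fun y => fderiv ℝ f y _) x _ = fderiv ℝ (fun y => fderiv ℝ f y _) x _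
  rw [key, key]
  exact hs _ _

lemma clm_apply_eq_sum {F : Type*} [NormedAddCommGroup F] [NormedSpace ℝ F]
    (L : EuclideanSpace ℝ (Fin n) →L[ℝ] F) (v : EuclideanSpace ℝ (Fin n)) :
    L v = ∑ i, v i • L (EuclideanSpace.single i 1) := by
  conv_lhs => rw [← (EuclideanSpace.basisFun (Fin n) ℝ).sum_repr v]
  simp [map_sum]

lemma inner_gradient_eq_sum (v : EuclideanSpace ℝ (Fin n)) :
    ⟪v, gradient f x⟫ = ∑ i, v i * pd i f x := by
  rw [real_inner_comm, ← InnerProductSpace.toDual_apply_apply (𝕜 := ℝ), toDual_gradient,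
    clm_apply_eq_sum]
  rfl

/-- First and second order necessary conditions at a local maximum, coordinatewise. -/
lemma pd_of_isLocalMax (hf : ContDiff ℝ ∞ f) (hmax : IsLocalMax f x) (i : Fin n) :
    pd i f x = 0 ∧ pd i (pd i f) x ≤ 0 := by
  refine ⟨by simp [pd, hmax.fderiv_eq_zero], ?_⟩
  set e : EuclideanSpace ℝ (Fin n) := EuclideanSpace.single i 1
  have hline (t : ℝ) : HasDerivAt (fun s : ℝ => x + s • e) e t := by
    simpa using ((hasDerivAt_id t).smul_const e).const_add x
  have hder (h : EuclideanSpace ℝ (Fin n) → ℝ) (hh : ContDiff ℝ ∞ h) (t : ℝ) :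
      HasDerivAt (fun s : ℝ => h (x + s • e)) (pd i h (x + t • e)) t :=
    (differentiableAt_of_smooth hh).hasFDerivAt.comp_hasDerivAt t (hline t)
  have hd1 : deriv (fun s : ℝ => f (x + s • e)) = fun t => pd i f (x + t • e) :=
    funext fun t => (hder f hf t).deriv
  have hd2 : deriv (deriv (fun s : ℝ => f (x + s • e))) 0 = pd i (pd i f) x := by
    rw [hd1, (hder _ (contDiff_pd i hf) 0).deriv]; simp
  have hmax1 : IsLocalMax (fun s : ℝ => f (x + s • e)) 0 := by
    have hx : IsLocalMax f (x + (0 : ℝ) • e) := by simpa using hmax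
    exact hx.comp_continuous (g := fun s : ℝ => x + s • e) (b := 0) (hline 0).continuousAt
  by_contra! hpos
  have hmin1 : IsLocalMin (fun s : ℝ => f (x + s • e)) 0 :=
    isLocalMin_of_deriv_deriv_pos (by rw [hd2]; exact hpos) hmax1.deriv_eq_zero
      (hder f hf 0).continuousAt
  have hconst : (fun s : ℝ => f (x + s • e)) =ᶠ[nhds 0] fun _ => f (x + (0 : ℝ) • e) := by
    filter_upwards [hmax1, hmin1] with s h1 h2 using le_antisymm h1 h2
  have := hconst.deriv.deriv_eq
  rw [hd2] at this
  simp at this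
  linarith

end PartialDerivatives

section Bochner

variable {n : ℕ} {g : EuclideanSpace ℝ (Fin n) → ℝ}
  {V : EuclideanSpace ℝ (Fin n) → EuclideanSpace ℝ (Fin n)}

/-- The squared norm of the gradient, in coordinates. -/
noncomputable def gradSq (g : EuclideanSpace ℝ (Fin n) → ℝ) (x : EuclideanSpace ℝ (Fin n)) : ℝ :=
  ∑ i, pd i g x ^ 2

lemma gradSq_nonneg (x : EuclideanSpace ℝ (Fin n)) : 0 ≤ gradSq g x :=
  Finset.sum_nonneg fun _ _ => sq_nonneg _

lemma contDiff_gradSq (hg : ContDiff ℝ ∞ g) : ContDiff ℝ ∞ (gradSq g) :=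
  ContDiff.sum fun i _ => (contDiff_pd i hg).pow 2

lemma contDiff_component (hV : ContDiff ℝ ∞ V) (i : Fin n) : ContDiff ℝ ∞ (fun y => V y i) :=
  (contDiff_coord i).comp hV

lemma pd_component (hV : ContDiff ℝ ∞ V) (i j : Fin n) (x : EuclideanSpace ℝ (Fin n)) :
    pd j (fun y => V y i) x = fderiv ℝ V x (EuclideanSpace.single j 1) i := by
  have : HasFDerivAt (fun y => V y i)
      ((EuclideanSpace.proj i : EuclideanSpace ℝ (Fin n) →L[ℝ] ℝ).comp (fderiv ℝ V x)) x :=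
    (EuclideanSpace.proj i : EuclideanSpace ℝ (Fin n) →L[ℝ] ℝ).hasFDerivAt.comp x
      (hV.differentiable (by simp) x).hasFDerivAt
  simp [pd, this.fderiv]

lemma inner_fderiv_eq_sum (hV : ContDiff ℝ ∞ V) (x ξ : EuclideanSpace ℝ (Fin n)) :
    ⟪fderiv ℝ V x ξ, ξ⟫ = ∑ j, ∑ i, ξ j * ξ i * pd j (fun y => V y i) x := by
  rw [clm_apply_eq_sum, sum_inner]
  refine Finset.sum_congr rfl fun j _ => ?_
  rw [real_inner_smul_left, PiLp.inner_apply, Finset.mul_sum]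
  refine Finset.sum_congr rfl fun i _ => ?_
  rw [pd_component hV]
  simp; ring

lemma pd_gradSq (hg : ContDiff ℝ ∞ g) (i : Fin n) (x : EuclideanSpace ℝ (Fin n)) :
    pd i (gradSq g) x = ∑ j, 2 * pd j g x * pd i (pd j g) x := by
  change pd i (fun y => ∑ j, pd j g y ^ 2) x = _
  rw [pd_sum i fun j => differentiableAt_of_smooth ((contDiff_pd j hg).pow 2)]
  exact Finset.sum_congr rfl fun j _ => pd_sq i (differentiableAt_of_smooth (contDiff_pd j hg))

lemma pd_pd_gradSq (hg : ContDiff ℝ ∞ g) (i : Fin n) (x : EuclideanSpace ℝ (Fin n)) :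
    pd i (pd i (gradSq g)) x =
      ∑ j, (2 * pd i (pd j g) x ^ 2 + 2 * pd j g x * pd i (pd i (pd j g)) x) := by
  rw [show pd i (gradSq g) = fun y => ∑ j, 2 * pd j g y * pd i (pd j g) y from
    funext (pd_gradSq hg i)]
  have h1 (j : Fin n) : ContDiff ℝ ∞ (pd j g) := contDiff_pd j hg
  have h2 (j : Fin n) : ContDiff ℝ ∞ (fun y => 2 * pd j g y) := contDiff_const.mul (h1 j)
  have h3 (j : Fin n) : ContDiff ℝ ∞ (pd i (pd j g)) := contDiff_pd i (h1 j)
  rw [pd_sum i fun j => differentiableAt_of_smooth ((h2 j).mul (h3 j))]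
  refine Finset.sum_congr rfl fun j _ => ?_
  rw [pd_mul i (differentiableAt_of_smooth (h2 j)) (differentiableAt_of_smooth (h3 j)),
    pd_const_mul i 2 (differentiableAt_of_smooth (h1 j))]
  ring

/-- The equation `Δ_V g + |∇g|² = α g`, differentiated in the direction `j`. -/
lemma pd_equation (hg : ContDiff ℝ ∞ g) (hV : ContDiff ℝ ∞ V) {α : ℝ}
    (heq : ∀ x, lap g x + ∑ i, V x i * pd i g x + gradSq g x = α * g x)
    (j : Fin n) (x : EuclideanSpace ℝ (Fin n)) :
    ∑ i, pd i (pd i (pd j g)) x +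
      ∑ i, (pd j (fun y => V y i) x * pd i g x + V x i * pd i (pd j g) x) +
      pd j (gradSq g) x = α * pd j g x := by
  have h1 (j : Fin n) : ContDiff ℝ ∞ (pd j g) := contDiff_pd j hg
  have h2 (i j : Fin n) : ContDiff ℝ ∞ (pd i (pd j g)) := contDiff_pd i (h1 j)
  have hVi := contDiff_component hV
  have hVg (i : Fin n) := (hVi i).mul (h1 i)
  have hsum1 : ContDiff ℝ ∞ (fun y => ∑ i, pd i (pd i g) y) := ContDiff.sum fun i _ => h2 i i
  have hsum2 : ContDiff ℝ ∞ (fun y => ∑ i, V y i * pd i g y) := ContDiff.sum fun i _ => hVg i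
  have h := congrArg (fun F => pd j F x) (funext heq)
  change pd j (fun y => (∑ i, pd i (pd i g) y) + (∑ i, V y i * pd i g y) + gradSq g y) x = _ at h
  rw [pd_add j (differentiableAt_of_smooth (hsum1.add hsum2))
      (differentiableAt_of_smooth (contDiff_gradSq hg)),
    pd_add j (differentiableAt_of_smooth hsum1) (differentiableAt_of_smooth hsum2),
    pd_sum j fun i => differentiableAt_of_smooth (h2 i i),
    pd_sum j fun i => differentiableAt_of_smooth (hVg i)] at h
  change _ = pd j (fun y => α * g y) x at h
  rw [pd_const_mul j α (differentiableAt_of_smooth hg)] at h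
  rw [← h]
  congr 2
  · refine Finset.sum_congr rfl fun i _ => ?_
    rw [pd_comm j i (h1 i), show pd j (pd i g) = pd i (pd j g) from
      funext fun _ => pd_comm j i hg]
  · refine Finset.sum_congr rfl fun i _ => ?_
    rw [pd_mul j (differentiableAt_of_smooth (hVi i)) (differentiableAt_of_smooth (h1 i)),
      pd_comm i j hg]

/-- Bochner's formula for solutions of `Δ_V g + |∇g|² = α g`. -/
lemma bochner_identity (hg : ContDiff ℝ ∞ g) (hV : ContDiff ℝ ∞ V) {α : ℝ}
    (heq : ∀ x, lap g x + ∑ i, V x i * pd i g x + gradSq g x = α * g x)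
    (x : EuclideanSpace ℝ (Fin n)) :
    1 / 2 * (lap (gradSq g) x + ∑ i, V x i * pd i (gradSq g) x) +
        ∑ i, pd i g x * pd i (gradSq g) x =
      ∑ i, ∑ j, pd i (pd j g) x ^ 2 + α * gradSq g x -
        ∑ j, ∑ i, pd j g x * pd i g x * pd j (fun y => V y i) x := by
  have hlap : lap (gradSq g) x = 2 * ∑ i, ∑ j, pd i (pd j g) x ^ 2 +
      2 * ∑ j, pd j g x * ∑ i, pd i (pd i (pd j g)) x := by
    simp only [lap_eq_sum_pd, pd_pd_gradSq hg, Finset.sum_add_distrib, Finset.mul_sum]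
    congr 1
    rw [Finset.sum_comm]
    exact Finset.sum_congr rfl fun _ _ => Finset.sum_congr rfl fun _ _ => by ring
  have hdrift : ∑ i, V x i * pd i (gradSq g) x =
      2 * ∑ j, pd j g x * ∑ i, V x i * pd i (pd j g) x := by
    simp only [pd_gradSq hg, Finset.mul_sum]
    rw [Finset.sum_comm]
    exact Finset.sum_congr rfl fun _ _ => Finset.sum_congr rfl fun _ _ => by ring
  have hmain : ∑ j, pd j g x * ∑ i, pd i (pd i (pd j g)) x +
      ∑ j, ∑ i, pd j g x * pd i g x * pd j (fun y => V y i) x +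
      ∑ j, pd j g x * ∑ i, V x i * pd i (pd j g) x +
      ∑ j, pd j g x * pd j (gradSq g) x = α * gradSq g x := by
    rw [gradSq, Finset.mul_sum, ← Finset.sum_add_distrib, ← Finset.sum_add_distrib,
      ← Finset.sum_add_distrib]
    refine Finset.sum_congr rfl fun j _ => ?_
    have h := congrArg (pd j g x * ·) (pd_equation hg hV heq j x)
    simp only [Finset.sum_add_distrib] at h
    have h' : ∑ i, pd j g x * pd i g x * pd j (fun y => V y i) x =
        pd j g x * ∑ i, pd j (fun y => V y i) x * pd i g x := by
      rw [Finset.mul_sum]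
      exact Finset.sum_congr rfl fun _ _ => by ring
    rw [h']
    linear_combination h
  rw [hlap, hdrift]
  linear_combination hmain

/-- The differential inequality for `|∇g|²` under the lower bound on the `N`-Bakry–Émery
curvature. -/
lemma bochner_inequality {N : ℕ} (hN : 0 < N) (hg : ContDiff ℝ ∞ g) (hV : ContDiff ℝ ∞ V)
    {K α : ℝ} (hK : K ≤ α)
    (hRic : ∀ x ξ : EuclideanSpace ℝ (Fin n),
      (1 / 2) * (⟪fderiv ℝ V x ξ, ξ⟫ + ⟪ξ, fderiv ℝ V x ξ⟫)
        + (1 / (N : ℝ)) * ⟪V x, ξ⟫ ^ 2 ≤ K * ‖ξ‖ ^ 2)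
    (heq : ∀ x, lap g x + ∑ i, V x i * pd i g x + gradSq g x = α * g x)
    (x : EuclideanSpace ℝ (Fin n)) :
    (α * g x - gradSq g x) ^ 2 ≤ 2 * (n + N) *
      (1 / 2 * (lap (gradSq g) x + ∑ i, V x i * pd i (gradSq g) x) +
        ∑ i, pd i g x * pd i (gradSq g) x) := by
  rw [bochner_identity hg hV heq]
  set P := ∑ i, ∑ j, pd i (pd j g) x ^ 2 with hP
  set T := ∑ i, V x i * pd i g x with hT
  have hcurv := hRic x (gradient g x)
  have hcoord (i : Fin n) : gradient g x i = pd i g x := by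
    rw [pd, ← toDual_gradient, InnerProductSpace.toDual_apply_apply]
    exact (by simp [EuclideanSpace.inner_single_right] :
      ∀ v : EuclideanSpace ℝ (Fin n), v i = ⟪v, EuclideanSpace.single i 1⟫) _
  have hnorm : ‖gradient g x‖ ^ 2 = gradSq g x := by
    rw [EuclideanSpace.real_norm_sq_eq]
    exact Finset.sum_congr rfl fun i _ => by rw [hcoord]
  rw [real_inner_comm (fderiv ℝ V x _), inner_fderiv_eq_sum hV, inner_gradient_eq_sum,
    hnorm] at hcurv
  simp only [hcoord] at hcurv
  rw [← hT] at hcurv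
  set W := ∑ j, ∑ i, pd j g x * pd i g x * pd j (fun y => V y i) x with hW
  have hNpos : (0 : ℝ) < N := by exact_mod_cast hN
  have hS : lap g x ^ 2 ≤ n * P := by
    rw [lap_eq_sum_pd]
    refine (sq_sum_le_card_mul_sum_sq (s := Finset.univ)).trans ?_
    rw [Finset.card_univ, Fintype.card_fin]
    refine mul_le_mul_of_nonneg_left (Finset.sum_le_sum fun i _ => ?_) (Nat.cast_nonneg n)
    exact Finset.single_le_sum (f := fun j => pd i (pd j g) x ^ 2) (fun _ _ => sq_nonneg _)
      (Finset.mem_univ i)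
  have hP0 : 0 ≤ P := Finset.sum_nonneg fun _ _ => Finset.sum_nonneg fun _ _ => sq_nonneg _
  have hQ0 := gradSq_nonneg (g := g) x
  have hkey : P + T ^ 2 / N ≤ P + α * gradSq g x - W := by
    have : 1 / (N : ℝ) * T ^ 2 = T ^ 2 / N := by ring
    nlinarith [mul_le_mul_of_nonneg_right hK hQ0]
  have hsq : (α * g x - gradSq g x) ^ 2 ≤ 2 * (n + N) * (P + T ^ 2 / N) := by
    rw [← heq x]
    have hT2 : N * (T ^ 2 / N) = T ^ 2 := by field_simp
    have : 0 ≤ (n : ℝ) * (T ^ 2 / N) := by positivity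
    nlinarith [sq_nonneg (lap g x - T), mul_nonneg hNpos.le hP0]
  exact hsq.trans (by gcongr)

end Bochner

section MaximumPrinciple

variable {n : ℕ} {g : EuclideanSpace ℝ (Fin n) → ℝ}
  {V : EuclideanSpace ℝ (Fin n) → EuclideanSpace ℝ (Fin n)}

/-- The curvature bound controls the radial part of the drift. -/
lemma inner_drift_le {N : ℕ} (hN : 0 < N) (hV : ContDiff ℝ ∞ V) {K : ℝ} (hK : 0 ≤ K)
    (hRic : ∀ x ξ : EuclideanSpace ℝ (Fin n),
      (1 / 2) * (⟪fderiv ℝ V x ξ, ξ⟫ + ⟪ξ, fderiv ℝ V x ξ⟫)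
        + (1 / (N : ℝ)) * ⟪V x, ξ⟫ ^ 2 ≤ K * ‖ξ‖ ^ 2)
    (x : EuclideanSpace ℝ (Fin n)) : ⟪V x, x⟫ ≤ (‖V 0‖ + N * K + 1) * ‖x‖ := by
  rcases eq_or_ne x 0 with rfl | hx
  · simp
  set A := ‖V 0‖ + N * K + 1 with hA
  set θ := ‖x‖⁻¹ • x with hθ
  have hxpos : 0 < ‖x‖ := norm_pos_iff.2 hx
  have hθ1 : ‖θ‖ = 1 := by rw [hθ, norm_smul, norm_inv, norm_norm]; field_simp
  have hxθ : ‖x‖ • θ = x := by rw [hθ, smul_smul, mul_inv_cancel₀ hxpos.ne', one_smul]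
  have hNpos : (0 : ℝ) < N := by exact_mod_cast hN
  have hder (t : ℝ) : HasDerivAt (fun s : ℝ => ⟪V (s • θ), θ⟫)
      ⟪fderiv ℝ V (t • θ) θ, θ⟫ t := by
    have hline : HasDerivAt (fun s : ℝ => s • θ) θ t := by
      simpa using (hasDerivAt_id t).smul_const θ
    have h1 : HasDerivAt (fun s : ℝ => V (s • θ)) (fderiv ℝ V (t • θ) θ) t :=
      (hV.differentiable (by simp) (t • θ)).hasFDerivAt.comp_hasDerivAt t hline
    simpa using h1.inner ℝ (hasDerivAt_const t θ)
  have hle : ⟪V (‖x‖ • θ), θ⟫ ≤ A := by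
    refine image_le_of_deriv_right_lt_deriv_boundary (a := 0) (b := ‖x‖)
      (f := fun s : ℝ => ⟪V (s • θ), θ⟫) (B := fun _ => A) (B' := fun _ => 0)
      (fun t _ => (hder t).continuousAt.continuousWithinAt)
      (fun t _ => (hder t).hasDerivWithinAt) ?_ (fun t => hasDerivAt_const t A) ?_
      ⟨hxpos.le, le_rfl⟩
    · have := real_inner_le_norm (V 0) θ
      simp only [zero_smul]
      rw [hθ1] at this
      nlinarith [mul_nonneg hNpos.le hK]
    · intro t _ ht
      have h := hRic (t • θ) θ
      rw [real_inner_comm, ht, hθ1] at h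
      have hA1 : N * K + 1 ≤ A := by rw [hA]; linarith [norm_nonneg (V 0)]
      have hlt : K < 1 / (N : ℝ) * A ^ 2 := by
        rw [one_div, inv_mul_eq_div, lt_div_iff₀ hNpos]
        nlinarith [mul_nonneg hNpos.le hK]
      rw [real_inner_comm] at h
      linarith
  rw [hxθ] at hle
  calc ⟪V x, x⟫ = ‖x‖ * ⟪V x, θ⟫ := by rw [hθ, real_inner_smul_right]; field_simp
    _ ≤ ‖x‖ * A := by gcongr
    _ = A * ‖x‖ := mul_comm _ _

lemma sum_mul_coord (v x : EuclideanSpace ℝ (Fin n)) : ∑ i, v i * x i = ⟪v, x⟫ := by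
  simp [PiLp.inner_apply, mul_comm]

lemma le_zero_of_le_mul {c B : ℝ} (hB : 0 ≤ B) (h : ∀ δ, 0 < δ → δ ≤ 1 → c ≤ δ * B) : c ≤ 0 := by
  by_contra! hc
  have hpos : 0 < c + B + 1 := by linarith
  have := h (c / (c + B + 1)) (by positivity) ((div_le_one hpos).2 (by linarith))
  rw [div_mul_eq_mul_div, le_div_iff₀ hpos] at this
  nlinarith

/-- Solutions of `Δ_V g + |∇g|² = α g` that are bounded above are nonpositive. -/
lemma nonpos_of_bddAbove (hg : ContDiff ℝ ∞ g) {α A M : ℝ} (hα : 0 < α)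
    (hA : ∀ x, ⟪V x, x⟫ ≤ A * ‖x‖) (hM : ∀ x, g x ≤ M)
    (heq : ∀ x, lap g x + ∑ i, V x i * pd i g x + gradSq g x = α * g x)
    (p : EuclideanSpace ℝ (Fin n)) : g p ≤ 0 := by
  set L := M - g p + ‖p‖ ^ 2 with hL
  have hL0 : 0 ≤ L := by nlinarith [hM p, sq_nonneg ‖p‖]
  have hcontr : α * g p ≤ 0 := by
    refine le_zero_of_le_mul (B := 2 * n + A ^ 2 + 5 * L + α * ‖p‖ ^ 2) (by positivity) ?_
    intro δ hδ hδ1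
    have hδ2 : δ ^ 2 ≤ δ := by nlinarith
    set F : EuclideanSpace ℝ (Fin n) → ℝ := fun y => g y - δ ^ 2 * ‖y‖ ^ 2 with hF
    have hsq : ContDiff ℝ ∞ (fun y : EuclideanSpace ℝ (Fin n) => ‖y‖ ^ 2) := contDiff_norm_sq ℝ
    have hδsq : ContDiff ℝ ∞ (fun y : EuclideanSpace ℝ (Fin n) => δ ^ 2 * ‖y‖ ^ 2) :=
      contDiff_const.mul hsq
    have hFs : ContDiff ℝ ∞ F := hg.sub hδsq
    obtain ⟨x, hx⟩ : ∃ x, ∀ y, F y ≤ F x := by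
      refine hFs.continuous.exists_forall_ge' p ?_
      have htend := (Filter.tendsto_pow_atTop (α := ℝ) (two_ne_zero)).comp
        (tendsto_norm_cocompact_atTop (E := EuclideanSpace ℝ (Fin n)))
      filter_upwards [htend.eventually_ge_atTop ((M - F p) / δ ^ 2)] with y hy
      rw [div_le_iff₀ (by positivity)] at hy
      simp only [Function.comp_apply] at hy
      simp only [hF] at hy ⊢
      linarith [hM y]
    have hFpd (i : Fin n) : pd i F = fun y => pd i g y - 2 * δ ^ 2 * y i := by
      funext y
      rw [hF, pd_sub i (differentiableAt_of_smooth hg) (differentiableAt_of_smooth hδsq),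
        pd_const_mul i _ (differentiableAt_of_smooth hsq), pd_norm_sq]
      ring
    have hmax (i : Fin n) : pd i g x = 2 * δ ^ 2 * x i ∧ pd i (pd i g) x ≤ 2 * δ ^ 2 := by
      obtain ⟨h1, h2⟩ := pd_of_isLocalMax hFs (Filter.Eventually.of_forall hx) i
      rw [hFpd] at h1 h2
      rw [pd_sub i (differentiableAt_of_smooth (contDiff_pd i hg))
        (differentiableAt_of_smooth (contDiff_const.mul (contDiff_coord i))),
        pd_const_mul i _ (differentiableAt_of_smooth (contDiff_coord i)), pd_coord] at h2
      constructor <;> linarith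
    have hlap : lap g x ≤ n * (2 * δ ^ 2) := by
      rw [lap_eq_sum_pd]
      simpa using Finset.sum_le_sum fun i (_ : i ∈ Finset.univ) => (hmax i).2
    have hdrift : ∑ i, V x i * pd i g x = 2 * δ ^ 2 * ⟪V x, x⟫ := by
      rw [← sum_mul_coord, Finset.mul_sum]
      exact Finset.sum_congr rfl fun i _ => by rw [(hmax i).1]; ring
    have hgrad : gradSq g x = 4 * δ ^ 4 * ‖x‖ ^ 2 := by
      rw [gradSq, EuclideanSpace.real_norm_sq_eq, Finset.mul_sum]
      exact Finset.sum_congr rfl fun i _ => by rw [(hmax i).1]; ring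
    have hxp := hx p
    simp only [hF] at hxp
    have hxL : δ ^ 2 * ‖x‖ ^ 2 ≤ L := by
      nlinarith [hM x, mul_le_mul_of_nonneg_right (hδ2.trans hδ1) (sq_nonneg ‖p‖)]
    have hgx : g p ≤ g x + δ * ‖p‖ ^ 2 := by
      nlinarith [mul_le_mul_of_nonneg_right hδ2 (sq_nonneg ‖p‖), sq_nonneg (δ * ‖x‖)]
    have hV1 : 2 * δ ^ 2 * ⟪V x, x⟫ ≤ δ * (A ^ 2 + L) := by
      have h1 : 2 * δ ^ 2 * ⟪V x, x⟫ ≤ 2 * δ ^ 2 * (A * ‖x‖) := by gcongr; exact hA x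
      have h2 : 2 * δ * (A * ‖x‖) ≤ A ^ 2 + δ ^ 2 * ‖x‖ ^ 2 := by
        nlinarith [sq_nonneg (A - δ * ‖x‖)]
      nlinarith [mul_le_mul_of_nonneg_left (h2.trans (add_le_add_right hxL _)) hδ.le]
    have hQ1 : 4 * δ ^ 4 * ‖x‖ ^ 2 ≤ 4 * (δ * L) := by
      have h1 : δ ^ 2 * (δ ^ 2 * ‖x‖ ^ 2) ≤ δ * L := by gcongr
      nlinarith
    have hn1 : n * (2 * δ ^ 2) ≤ δ * (2 * n) := by
      nlinarith [mul_le_mul_of_nonneg_left hδ2 (Nat.cast_nonneg (α := ℝ) n)]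
    have hx' := heq x
    rw [hdrift, hgrad] at hx'
    nlinarith [mul_le_mul_of_nonneg_left hgx hα.le]
  by_contra! hpos
  nlinarith [mul_pos hα hpos]

/-- A localized gradient bound on the ball of radius `R`. -/
lemma gradSq_localized (hg : ContDiff ℝ ∞ g) {m A : ℝ} (hm : 0 < m) (hA0 : 0 ≤ A)
    (hA : ∀ x, ⟪V x, x⟫ ≤ A * ‖x‖)
    (hineq : ∀ x, gradSq g x ^ 2 ≤ m *
      (1 / 2 * (lap (gradSq g) x + ∑ i, V x i * pd i (gradSq g) x) +
        ∑ i, pd i g x * pd i (gradSq g) x))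
    {R : ℝ} (hR : 1 ≤ R) {p : EuclideanSpace ℝ (Fin n)} (hp : ‖p‖ ≤ R) :
    (R ^ 2 - ‖p‖ ^ 2) ^ 2 * gradSq g p ≤ 2 * m * (12 + 2 * n + 2 * A + 8 * m) * R ^ 3 := by
  set q := gradSq g with hq
  have hqs : ContDiff ℝ ∞ q := contDiff_gradSq hg
  set η : EuclideanSpace ℝ (Fin n) → ℝ := fun y => R ^ 2 - ‖y‖ ^ 2 with hη
  have hsq : ContDiff ℝ ∞ (fun y : EuclideanSpace ℝ (Fin n) => ‖y‖ ^ 2) := contDiff_norm_sq ℝ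
  have hηs : ContDiff ℝ ∞ η := contDiff_const.sub hsq
  have hFs : ContDiff ℝ ∞ (fun y => η y ^ 2 * q y) := (hηs.pow 2).mul hqs
  have hR0 : 0 < R := by linarith
  obtain ⟨x, hxR, hx⟩ := (isCompact_closedBall (0 : EuclideanSpace ℝ (Fin n)) R).exists_isMaxOn
    ⟨0, by simp [hR0.le]⟩ hFs.continuous.continuousOn
  refine (hx (show p ∈ Metric.closedBall 0 R by simpa using hp)).trans ?_
  change η x ^ 2 * q x ≤ _
  rw [mem_closedBall_zero_iff] at hxR
  rcases le_or_gt (η x ^ 2 * q x) 0 with hle | hpos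
  · exact hle.trans (by positivity)
  have hηx : 0 < η x := by
    refine lt_of_le_of_ne ?_ fun h => by simp [← h] at hpos
    simp only [hη]
    nlinarith [norm_nonneg x]
  have hqx : 0 < q x := pos_of_mul_pos_right hpos (sq_nonneg _)
  have hlt : ‖x‖ < R := by
    simp only [hη] at hηx
    nlinarith [norm_nonneg x]
  have hloc : IsLocalMax (fun y => η y ^ 2 * q y) x :=
    hx.isLocalMax (Filter.mem_of_superset
      (Metric.isOpen_ball.mem_nhds (by simpa using hlt)) Metric.ball_subset_closedBall)
  have hηpd (i : Fin n) (y : EuclideanSpace ℝ (Fin n)) : pd i η y = -2 * y i := by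
    rw [hη, pd_sub i (differentiableAt_const _) (differentiableAt_of_smooth hsq), pd_const,
      pd_norm_sq]
    ring
  have hFpd (i : Fin n) : pd i (fun y => η y ^ 2 * q y) =
      fun y => -4 * (η y * y i) * q y + η y ^ 2 * pd i q y := by
    funext y
    rw [pd_mul i (differentiableAt_of_smooth (hηs.pow 2)) (differentiableAt_of_smooth hqs),
      pd_sq i (differentiableAt_of_smooth hηs), hηpd]
    ring
  have hcrit (i : Fin n) : η x * pd i q x = 4 * q x * x i := by
    have h := (pd_of_isLocalMax hFs hloc i).1
    rw [hFpd] at h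
    have : η x * (η x * pd i q x - 4 * q x * x i) = 0 := by linear_combination h
    linarith [(mul_eq_zero.1 this).resolve_left hηx.ne']
  have hhess (i : Fin n) : η x ^ 2 * pd i (pd i q) x ≤ 24 * q x * x i ^ 2 + 4 * η x * q x := by
    have h := (pd_of_isLocalMax hFs hloc i).2
    have hηc : ContDiff ℝ ∞ (fun y => η y * y i) := hηs.mul (contDiff_coord i)
    have hc : ContDiff ℝ ∞ (fun y => -4 * (η y * y i)) := contDiff_const.mul hηc
    rw [hFpd, pd_add i (differentiableAt_of_smooth (hc.mul hqs))
        (differentiableAt_of_smooth ((hηs.pow 2).mul (contDiff_pd i hqs))),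
      pd_mul i (differentiableAt_of_smooth hc) (differentiableAt_of_smooth hqs),
      pd_const_mul i _ (differentiableAt_of_smooth hηc),
      pd_mul i (differentiableAt_of_smooth hηs) (differentiableAt_of_smooth (contDiff_coord i)),
      pd_mul i (differentiableAt_of_smooth (hηs.pow 2))
        (differentiableAt_of_smooth (contDiff_pd i hqs)),
      pd_sq i (differentiableAt_of_smooth hηs), hηpd, pd_coord] at h
    have h8 : 8 * x i * (η x * pd i q x) = 8 * x i * (4 * q x * x i) := by rw [hcrit]
    linarith
  have hlap : η x ^ 2 * lap q x ≤ 24 * q x * ‖x‖ ^ 2 + 4 * n * η x * q x := by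
    rw [lap_eq_sum_pd, EuclideanSpace.real_norm_sq_eq, Finset.mul_sum, Finset.mul_sum]
    refine (Finset.sum_le_sum fun i _ => hhess i).trans_eq ?_
    rw [Finset.sum_add_distrib]
    simp
    ring
  have hdrift : η x * ∑ i, V x i * pd i q x = 4 * q x * ⟪V x, x⟫ := by
    rw [← sum_mul_coord, Finset.mul_sum, Finset.mul_sum]
    exact Finset.sum_congr rfl fun i _ => by linear_combination V x i * hcrit i
  have hgrad : η x * ∑ i, pd i g x * pd i q x = 4 * q x * ∑ i, pd i g x * x i := by
    rw [Finset.mul_sum, Finset.mul_sum]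
    exact Finset.sum_congr rfl fun i _ => by linear_combination pd i g x * hcrit i
  set Y := ∑ i, pd i g x * x i with hY
  have hyoung : 8 * m * η x * Y ≤ 16 * m ^ 2 * ‖x‖ ^ 2 + η x ^ 2 * q x := by
    have h : 0 ≤ ∑ i, (4 * m * x i - η x * pd i g x) ^ 2 :=
      Finset.sum_nonneg fun _ _ => sq_nonneg _
    have hexp : ∑ i, (4 * m * x i - η x * pd i g x) ^ 2 =
        16 * m ^ 2 * ‖x‖ ^ 2 - 8 * m * η x * Y + η x ^ 2 * q x := by
      rw [EuclideanSpace.real_norm_sq_eq, hY, hq, gradSq, Finset.mul_sum, Finset.mul_sum,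
        Finset.mul_sum, ← Finset.sum_sub_distrib, ← Finset.sum_add_distrib]
      exact Finset.sum_congr rfl fun i _ => by ring
    linarith
  have hmain : η x ^ 2 * q x ≤
      m * (12 * ‖x‖ ^ 2 + 2 * n * η x + 2 * η x * ⟪V x, x⟫ + 4 * η x * Y) := by
    refine le_of_mul_le_mul_left ?_ hqx
    have h1 := mul_le_mul_of_nonneg_left (hineq x) (sq_nonneg (η x))
    have h2 := mul_le_mul_of_nonneg_left hlap hm.le
    have h3 : η x ^ 2 * ∑ i, V x i * pd i q x = η x * (4 * q x * ⟪V x, x⟫) := by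
      rw [← hdrift]; ring
    have h4 : η x ^ 2 * ∑ i, pd i g x * pd i q x = η x * (4 * q x * Y) := by
      rw [← hgrad]; ring
    have h5 := congrArg (m * ·) h3
    have h6 := congrArg (m * ·) h4
    simp only at h5 h6
    linarith
  have hxR2 : ‖x‖ ^ 2 ≤ R ^ 2 := by gcongr
  have hηR : η x ≤ R ^ 2 := by simp only [hη]; linarith [sq_nonneg ‖x‖]
  have hR23 : R ^ 2 ≤ R ^ 3 := pow_le_pow_right₀ hR (by norm_num)
  have hV1 : η x * ⟪V x, x⟫ ≤ A * R ^ 3 :=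
    calc η x * ⟪V x, x⟫ ≤ η x * (A * ‖x‖) := by gcongr; exact hA x
      _ ≤ R ^ 2 * (A * R) := by gcongr
      _ = A * R ^ 3 := by ring
  have hsum : 12 * ‖x‖ ^ 2 + 2 * n * η x + 2 * (η x * ⟪V x, x⟫) + 8 * m * ‖x‖ ^ 2 ≤
      (12 + 2 * n + 2 * A + 8 * m) * R ^ 3 := by
    have h1 : 2 * n * η x ≤ 2 * n * R ^ 3 := by gcongr; exact hηR.trans hR23
    have h2 : 8 * m * ‖x‖ ^ 2 ≤ 8 * m * R ^ 3 := by gcongr; exact hxR2.trans hR23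
    linarith
  have := mul_le_mul_of_nonneg_left hsum hm.le
  linarith

lemma gradSq_eq_zero (hg : ContDiff ℝ ∞ g) {m A : ℝ} (hm : 0 < m) (hA0 : 0 ≤ A)
    (hA : ∀ x, ⟪V x, x⟫ ≤ A * ‖x‖)
    (hineq : ∀ x, gradSq g x ^ 2 ≤ m *
      (1 / 2 * (lap (gradSq g) x + ∑ i, V x i * pd i (gradSq g) x) +
        ∑ i, pd i g x * pd i (gradSq g) x))
    (p : EuclideanSpace ℝ (Fin n)) : gradSq g p = 0 := by
  refine le_antisymm ?_ (gradSq_nonneg p)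
  set B := 2 * m * (12 + 2 * n + 2 * A + 8 * m) with hB
  have hB0 : 0 ≤ B := by positivity
  refine le_zero_of_le_mul (B := 4 * (2 * ‖p‖ + 1) * B) (by positivity) fun δ hδ hδ1 => ?_
  set R := (2 * ‖p‖ + 1) / δ with hR
  have hRp : 2 * ‖p‖ + 1 ≤ R := le_div_self (by positivity) hδ hδ1
  have hp0 := norm_nonneg p
  have hRpos : 0 < R := by linarith
  have hloc := gradSq_localized hg hm hA0 hA hineq (R := R) (p := p) (by linarith) (by linarith)
  have h1 : R ^ 2 / 2 ≤ R ^ 2 - ‖p‖ ^ 2 := by nlinarith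
  have h2 : (R ^ 2 / 2) ^ 2 * gradSq g p ≤ B * R ^ 3 :=
    (mul_le_mul_of_nonneg_right (pow_le_pow_left₀ (by positivity) h1 2)
      (gradSq_nonneg p)).trans hloc
  have h3 : R * gradSq g p ≤ 4 * B := by
    have : R ^ 3 * (R * gradSq g p) ≤ R ^ 3 * (4 * B) := by linarith
    exact le_of_mul_le_mul_left this (by positivity)
  have h4 : δ * R = 2 * ‖p‖ + 1 := by rw [hR]; field_simp
  have h5 : (2 * ‖p‖ + 1) * gradSq g p ≤ δ * (4 * B) := by
    rw [← h4, mul_assoc]; gcongr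
  have h6 : δ * (4 * B) ≤ δ * (4 * (2 * ‖p‖ + 1) * B) := by
    gcongr; linarith
  nlinarith [gradSq_nonneg (g := g) p]

end MaximumPrinciple

lemma pd_log {n : ℕ} {u : EuclideanSpace ℝ (Fin n) → ℝ} {x : EuclideanSpace ℝ (Fin n)}
    (hu : DifferentiableAt ℝ u x) (hx : u x ≠ 0) (c : ℝ) (i : Fin n) :
    pd i (fun y => Real.log (u y) + c) x = (u x)⁻¹ * pd i u x := by
  simp [pd, (((hu.hasFDerivAt).log hx).add_const c).fderiv]

/-- The logarithm of a positive function satisfies `Δ log u + |∇ log u|² = u⁻¹ Δu`. -/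
lemma lap_log_add_gradSq {n : ℕ} {u : EuclideanSpace ℝ (Fin n) → ℝ} (hu : ContDiff ℝ ∞ u)
    (hpos : ∀ x, 0 < u x) (c : ℝ) (x : EuclideanSpace ℝ (Fin n)) :
    lap (fun y => Real.log (u y) + c) x + gradSq (fun y => Real.log (u y) + c) x =
      (u x)⁻¹ * lap u x := by
  rw [lap_eq_sum_pd, lap_eq_sum_pd, gradSq, ← Finset.sum_add_distrib, Finset.mul_sum]
  refine Finset.sum_congr rfl fun i _ => ?_
  set f : EuclideanSpace ℝ (Fin n) → ℝ := fun y => Real.log (u y) + c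
  have hfs : ContDiff ℝ ∞ f := (hu.log fun y => (hpos y).ne').add contDiff_const
  have h : pd i u = fun y => u y * pd i f y := by
    funext y
    rw [pd_log (differentiableAt_of_smooth hu) (hpos y).ne', mul_inv_cancel_left₀ (hpos y).ne']
  have h2 : pd i (pd i u) x = pd i u x * pd i f x + u x * pd i (pd i f) x := by
    conv_lhs => rw [h]
    exact pd_mul i (differentiableAt_of_smooth hu)
      (differentiableAt_of_smooth (contDiff_pd i hfs))
  have hux := (hpos x).ne'
  rw [h2, h]
  field_simp
  ring

end EuclideanLiouville

/-- **Liouville-type theorem for solutions bounded by `C`** (Euclidean instance of the final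
remark of Section 3): under the `Ric_V^N ≥ -K` condition, if `a < 0`, `b ≤ 0` are constants
with `a ≤ -K`, `C ≥ 1`, and `u` is a smooth positive solution of
`Δu + ⟨V, ∇u⟩ + a u log u + b u = 0` with `u ≤ C`, then `u ≡ e^{-b/a}`. -/
theorem liouville_bounded_by_C {n : ℕ} (N : ℕ) (hN : 0 < N)
    (V : EuclideanSpace ℝ (Fin n) → EuclideanSpace ℝ (Fin n)) (hV : ContDiff ℝ ∞ V)
    (K : ℝ) (hK : 0 ≤ K)
    (hRic : ∀ x ξ : EuclideanSpace ℝ (Fin n),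
      (1 / 2) * (⟪fderiv ℝ V x ξ, ξ⟫ + ⟪ξ, fderiv ℝ V x ξ⟫)
        + (1 / (N : ℝ)) * ⟪V x, ξ⟫ ^ 2 ≤ K * ‖ξ‖ ^ 2)
    (a b : ℝ) (ha : a < 0) (hb : b ≤ 0) (haK : a ≤ -K)
    (C : ℝ) (hC : 1 ≤ C)
    (u : EuclideanSpace ℝ (Fin n) → ℝ) (hu_smooth : ContDiff ℝ ∞ u)
    (hu_pos : ∀ x, 0 < u x) (hu_le : ∀ x, u x ≤ C)
    (heq : ∀ x, lap u x + ⟪V x, gradient u x⟫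
      + a * u x * Real.log (u x) + b * u x = 0) :
    ∀ x, u x = Real.exp (-b / a) := by
  open EuclideanLiouville in
  set g : EuclideanSpace ℝ (Fin n) → ℝ := fun y => Real.log (u y) + b / a with hgdef
  have hg : ContDiff ℝ ∞ g := (hu_smooth.log fun y => (hu_pos y).ne').add contDiff_const
  have hgeq (x : EuclideanSpace ℝ (Fin n)) :
      lap g x + ∑ i, V x i * pd i g x + gradSq g x = -a * g x := by
    have hux := (hu_pos x).ne'
    have h1 := lap_log_add_gradSq hu_smooth hu_pos (b / a) x
    have h2 : ∑ i, V x i * pd i g x = (u x)⁻¹ * ⟪V x, gradient u x⟫ := by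
      rw [inner_gradient_eq_sum, Finset.mul_sum]
      refine Finset.sum_congr rfl fun i _ => ?_
      rw [hgdef, pd_log (differentiableAt_of_smooth hu_smooth) hux]
      ring
    have h3 : lap u x + ⟪V x, gradient u x⟫ = u x * (-a * g x) := by
      have : a * (b / a) = b := mul_div_cancel₀ b ha.ne
      simp only [hgdef]
      linear_combination heq x + u x * this
    rw [h2, add_right_comm, h1, ← mul_add, h3, inv_mul_cancel_left₀ hux]
  have hA := inner_drift_le hN hV hK hRic
  have hg0 := nonpos_of_bddAbove hg (neg_pos.2 ha) hA
    (fun x => add_le_add_left (Real.log_le_log (hu_pos x) (hu_le x)) (b / a)) hgeq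
  have hNpos : (0 : ℝ) < N := by exact_mod_cast hN
  have hQ := gradSq_eq_zero (V := V) hg (m := 2 * (n + N)) (by positivity) (by positivity) hA
    fun x => by
      refine le_trans ?_ (bochner_inequality hN hg hV (le_neg.1 haK) hRic hgeq x)
      have h1 : 0 ≤ a * g x := mul_nonneg_of_nonpos_of_nonpos ha.le (hg0 x)
      nlinarith [gradSq_nonneg (g := g) x, mul_nonneg h1 (gradSq_nonneg (g := g) x)]
  have hpd (i : Fin n) (y : EuclideanSpace ℝ (Fin n)) : pd i g y = 0 :=
    pow_eq_zero_iff two_ne_zero |>.1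
      ((Finset.sum_eq_zero_iff_of_nonneg fun _ _ => sq_nonneg _).1 (hQ y) i (Finset.mem_univ i))
  intro x
  have hgx := hgeq x
  rw [lap_eq_sum_pd, hQ, Finset.sum_eq_zero fun i _ => by rw [funext (hpd i), pd_const],
    Finset.sum_eq_zero fun i _ => by rw [hpd, mul_zero]] at hgx
  have hzero : g x = 0 := by
    have := mul_eq_zero.1 (show -a * g x = 0 by linarith)
    exact this.resolve_left (neg_pos.2 ha).ne'
  rw [neg_div, ← Real.exp_log (hu_pos x)]
  congr 1
  simp only [hgdef] at hzero
  linarith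
end

section
/- Let L ≥ 0 and let v : [0,1] → ℝ be a differentiable function with 0 < v(s) ≤ 1 and |v′(s)| ≤ L · v(s) · (1 − log v(s)) for all s ∈ [0,1]. Then v(0) ≤ v(1)^β · e^{1−β}, where β = e^{−L}. -/
/-- Real-variable core of the Harnack inequality (Corollary 3.1): if `v : [0,1] → ℝ`
is differentiable with `0 < v ≤ 1` and `|v'| ≤ L v (1 - log v)` on `[0,1]`, then
`v(0) ≤ v(1)^β e^{1-β}` where `β = e^{-L}`. -/
theorem harnack_ode_core (L : ℝ) (hL : 0 ≤ L) (v v' : ℝ → ℝ)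
    (hderiv : ∀ s ∈ Set.Icc (0 : ℝ) 1, HasDerivWithinAt v (v' s) (Set.Icc (0 : ℝ) 1) s)
    (hv_pos : ∀ s ∈ Set.Icc (0 : ℝ) 1, 0 < v s)
    (hv_le : ∀ s ∈ Set.Icc (0 : ℝ) 1, v s ≤ 1)
    (hbound : ∀ s ∈ Set.Icc (0 : ℝ) 1, |v' s| ≤ L * v s * (1 - Real.log (v s))) :
    v 0 ≤ v 1 ^ Real.exp (-L) * Real.exp (1 - Real.exp (-L)) := by
  have hw : ∀ s ∈ Set.Icc (0 : ℝ) 1, 0 < 1 - Real.log (v s) := fun s hs => by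
    linarith [Real.log_nonpos (hv_pos s hs).le (hv_le s hs)]
  have hg : ∀ s ∈ Set.Icc (0 : ℝ) 1,
      HasDerivWithinAt (fun s => Real.log (1 - Real.log (v s)))
        (-(v' s / v s) / (1 - Real.log (v s))) (Set.Icc (0 : ℝ) 1) s := fun s hs =>
    (((hderiv s hs).log (hv_pos s hs).ne').const_sub 1).log (hw s hs).ne'
  have hg_bound : ∀ s ∈ Set.Icc (0 : ℝ) 1,
      ‖-(v' s / v s) / (1 - Real.log (v s))‖ ≤ L := fun s hs => by
    rw [Real.norm_eq_abs, abs_div, abs_neg, abs_div, abs_of_pos (hv_pos s hs),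
      abs_of_pos (hw s hs), div_div, div_le_iff₀ (mul_pos (hv_pos s hs) (hw s hs)), ← mul_assoc]
    exact hbound s hs
  have h0 : (0 : ℝ) ∈ Set.Icc (0 : ℝ) 1 := by simp
  have h1 : (1 : ℝ) ∈ Set.Icc (0 : ℝ) 1 := by simp
  have hlog := (convex_Icc (0 : ℝ) 1).norm_image_sub_le_of_norm_hasDerivWithin_le
    hg hg_bound h0 h1
  rw [Real.norm_eq_abs, sub_zero, norm_one, mul_one] at hlog
  have hexp : (1 - Real.log (v 1)) * Real.exp (-L) ≤ 1 - Real.log (v 0) := by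
    rw [← Real.log_le_log_iff (mul_pos (hw 1 h1) (Real.exp_pos _)) (hw 0 h0),
      Real.log_mul (hw 1 h1).ne' (Real.exp_pos _).ne', Real.log_exp]
    linarith [le_of_abs_le hlog]
  rw [Real.rpow_def_of_pos (hv_pos 1 h1), ← Real.exp_add,
    ← Real.log_le_iff_le_exp (hv_pos 0 h0)]
  linarith
end
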